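/- arXiv:2310.09455 — 3 statements merged into one kernel-verified Lean document; each statement's English description precedes it below -/
import Mathlib

section
/- Every countable group G can be embedded into a finitely generated group C with property (NL). -/
noncomputable section

open Metric

/-- The Gromov product of `x` and `y` at `w` with respect to a distance function `d`. -/
def gromovProd {α : Type*} (d : α → α → ℝ) (w x y : α) : ℝ :=
  (d w x + d w y - d x y) / 2

/-- Gromov hyperbolicity via the four-point condition, for an arbitrary distance function. -/
def FourPointHyperbolic {α : Type*} (d : α → α → ℝ) : Prop :=
  ∃ δ : ℝ, 0 ≤ δ ∧ ∀ w x y z : α,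
    min (gromovProd d w x z) (gromovProd d w z y) - δ ≤ gromovProd d w x y

/-- A geodesic from `x` to `y`, parametrized by arc length on `[0, dist x y]`. -/
def IsGeodesicSeg {X : Type*} [MetricSpace X] (x y : X) (f : ℝ → X) : Prop :=
  f 0 = x ∧ f (dist x y) = y ∧
    ∀ s ∈ Set.Icc (0 : ℝ) (dist x y), ∀ t ∈ Set.Icc (0 : ℝ) (dist x y),
      dist (f s) (f t) = |s - t|

/-- A geodesic metric space: any two points are joined by a geodesic. -/
def GeodesicSpace (X : Type*) [MetricSpace X] : Prop :=
  ∀ x y : X, ∃ f : ℝ → X, IsGeodesicSeg x y f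

/-- The image (as a set) of a geodesic segment from `x` to `y`. -/
def geodSet {X : Type*} [MetricSpace X] (x y : X) (f : ℝ → X) : Set X :=
  f '' Set.Icc (0 : ℝ) (dist x y)

/-- `p` lies within distance `δ` of the set `S` (i.e. in the closed `δ`-neighborhood). -/
def WithinDistOf {X : Type*} [MetricSpace X] (δ : ℝ) (p : X) (S : Set X) : Prop :=
  ∃ q ∈ S, dist p q ≤ δ

/-- Rips condition: each side of every geodesic triangle is contained in the union of the
closed `δ`-neighborhoods of the other two sides. -/
def RipsHyperbolic (X : Type*) [MetricSpace X] (δ : ℝ) : Prop :=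
  ∀ x y z : X, ∀ fxy fyz fxz : ℝ → X,
    IsGeodesicSeg x y fxy → IsGeodesicSeg y z fyz → IsGeodesicSeg x z fxz →
      (∀ p ∈ geodSet x y fxy, WithinDistOf δ p (geodSet y z fyz ∪ geodSet x z fxz)) ∧
      (∀ p ∈ geodSet y z fyz, WithinDistOf δ p (geodSet x y fxy ∪ geodSet x z fxz)) ∧
      (∀ p ∈ geodSet x z fxz, WithinDistOf δ p (geodSet x y fxy ∪ geodSet y z fyz))

/-- An (isometric) action of a group `G` on a metric space `X`. -/
structure IsIsomAction (G : Type*) [Group G] (X : Type*) [MetricSpace X]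
    (act : G → X → X) : Prop where
  act_one : ∀ x : X, act 1 x = x
  act_mul : ∀ (g h : G) (x : X), act (g * h) x = act g (act h x)
  isometry : ∀ (g : G) (x y : X), dist (act g x) (act g y) = dist x y

/-- A cobounded action: some (hence any) orbit is coarsely dense. -/
def CoboundedAction {G X : Type*} [Group G] [MetricSpace X] (act : G → X → X) : Prop :=
  ∃ (x : X) (R : ℝ), 0 ≤ R ∧ ∀ y : X, ∃ g : G, dist y (act g x) ≤ R

/-- A quasi-isometric embedding between two "spaces" given by distance functions. -/
def IsQIEmbWith {α β : Type*} (dα : α → α → ℝ) (dβ : β → β → ℝ) (f : α → β) : Prop :=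
  ∃ A B : ℝ, 1 ≤ A ∧ 0 ≤ B ∧ ∀ x y : α,
    dα x y / A - B ≤ dβ (f x) (f y) ∧ dβ (f x) (f y) ≤ A * dα x y + B

/-- The image of `f` is coarsely dense. -/
def CoarselyDenseWith {α β : Type*} (dβ : β → β → ℝ) (f : α → β) : Prop :=
  ∃ C : ℝ, 0 ≤ C ∧ ∀ y : β, ∃ x : α, dβ (f x) y ≤ C

/-- A quasi-isometry between two "spaces" given by distance functions. -/
def IsQuasiIsometryWith {α β : Type*} (dα : α → α → ℝ) (dβ : β → β → ℝ) (f : α → β) : Prop :=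
  IsQIEmbWith dα dβ f ∧ CoarselyDenseWith dβ f

/-- The standard distance on `ℤ`. -/
def zdist : ℤ → ℤ → ℝ := fun m n => |(m : ℝ) - (n : ℝ)|

/-- `g` is loxodromic for the action `act`: for some basepoint `x`, the orbit map
`n ↦ g ^ n • x` is a quasi-isometric embedding of `ℤ`. -/
def LoxodromicWith {G α : Type*} [Group G] (d : α → α → ℝ) (act : G → α → α) (g : G) : Prop :=
  ∃ x : α, IsQIEmbWith zdist d (fun n : ℤ => act (g ^ n) x)

/-- Acylindricity of an action, with respect to a distance function. -/
def AcylindricalWith {G α : Type*} (d : α → α → ℝ) (act : G → α → α) : Prop :=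
  ∀ ε : ℝ, 0 < ε → ∃ (R : ℝ) (N : ℕ), 0 ≤ R ∧ ∀ x y : α, R ≤ d x y →
    {g : G | d x (act g x) ≤ ε ∧ d y (act g y) ≤ ε}.Finite ∧
    Nat.card {g : G | d x (act g x) ≤ ε ∧ d y (act g y) ≤ ε} ≤ N

/-- Two subsets are within finite Hausdorff distance of each other. -/
def FinHausdorffClose {α : Type*} (d : α → α → ℝ) (A B : Set α) : Prop :=
  ∃ C : ℝ, (∀ a ∈ A, ∃ b ∈ B, d a b ≤ C) ∧ (∀ b ∈ B, ∃ a ∈ A, d a b ≤ C)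

/-- The positive (`pos = true`) or negative (`pos = false`) orbit ray of `g` at `x`. -/
def orbitRay {G α : Type*} [Group G] (act : G → α → α) (g : G) (x : α) (pos : Bool) : Set α :=
  Set.range fun n : ℕ => act (g ^ (if pos then (n : ℤ) else -(n : ℤ))) x

/-- Independence of two loxodromic elements with respect to the basepoint `x`: no orbit ray of
`g` is within finite Hausdorff distance of an orbit ray of `h`. -/
def IndepWith {G α : Type*} [Group G] (d : α → α → ℝ) (act : G → α → α) (x : α)
    (g h : G) : Prop :=
  ∀ s t : Bool, ¬ FinHausdorffClose d (orbitRay act g x s) (orbitRay act h x t)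

/-- A group is virtually cyclic if it has a cyclic subgroup of finite index. -/
def VirtuallyCyclic (G : Type*) [Group G] : Prop :=
  ∃ H : Subgroup G, IsCyclic ↥H ∧ H.FiniteIndex

/-- `S` is a generating set of `G`. -/
def IsGenSet {G : Type*} [Group G] (S : Set G) : Prop :=
  Subgroup.closure S = ⊤

/-- The word length of `g` with respect to `S`: the least `n` such that `g` is a product of
`n` elements of `S ∪ S⁻¹`. -/
def wordLength {G : Type*} [Group G] (S : Set G) (g : G) : ℕ :=
  sInf {n : ℕ | ∃ l : List G, l.length = n ∧ (∀ s ∈ l, s ∈ S ∨ s⁻¹ ∈ S) ∧ l.prod = g}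

/-- The word metric `d_S(g,h) = ‖g⁻¹h‖_S` on `G`. -/
def wordDist {G : Type*} [Group G] (S : Set G) : G → G → ℝ :=
  fun g h => (wordLength S (g⁻¹ * h) : ℝ)

/-- `S ⪯ T` : `S` is dominated by `T`, i.e. `sup_{t ∈ T} ‖t‖_S < ∞`. -/
def GenSetDominated {G : Type*} [Group G] (S T : Set G) : Prop :=
  ∃ M : ℕ, ∀ t ∈ T, wordLength S t ≤ M

/-- Equivalence of generating sets: mutual domination. -/
def GenSetEquiv {G : Type*} [Group G] (S T : Set G) : Prop :=
  GenSetDominated S T ∧ GenSetDominated T S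

/-- The left multiplication action of a group on itself. -/
def leftTranslation {G : Type*} [Group G] : G → G → G := fun g x => g * x

universe uX uG

/-- A bundled isometric action of `G` on a geodesic, δ-hyperbolic (Rips condition)
metric space. -/
structure GrpActHypSpace (G : Type uG) [Group G] : Type (max uG (uX + 1)) where
  carrier : Type uX
  [inst : MetricSpace carrier]
  act : G → carrier → carrier
  isIsomAction : IsIsomAction G carrier act
  δ : ℝ
  δ_nonneg : 0 ≤ δ
  geodesic : GeodesicSpace carrier
  rips : RipsHyperbolic carrier δ

attribute [instance] GrpActHypSpace.inst

/-- Property (NL): no isometric action of `G` on a geodesic Gromov-hyperbolic metric space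
has a loxodromic element. -/
def PropNL (G : Type uG) [Group G] : Prop :=
  ∀ A : GrpActHypSpace.{uX, uG} G, ∀ g : G,
    ¬ LoxodromicWith (fun a b : A.carrier => dist a b) A.act g

/-- A bundled embedding of a group `G` into another group. -/
structure EmbeddingIntoGroup (G : Type uG) [Group G] : Type (uG + 1) where
  target : Type uG
  [grp : Group target]
  hom : G →* target
  injective : Function.Injective hom

attribute [instance] EmbeddingIntoGroup.grp

section

open scoped commutatorElement

namespace GuptaSidki

/-- The vertices of the rooted ternary tree. -/
abbrev Tree : Type := List (ZMod 3)

/-- The automorphism of the ternary tree fixing the first level and acting as `v i` on the `i`-th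
subtree. -/
def branch : (ZMod 3 → Equiv.Perm Tree) →* Equiv.Perm Tree where
  toFun v :=
    { toFun := fun l => match l with
        | [] => []
        | i :: l => i :: v i l
      invFun := fun l => match l with
        | [] => []
        | i :: l => i :: (v i)⁻¹ l
      left_inv := by rintro (_ | ⟨i, l⟩) <;> simp
      right_inv := by rintro (_ | ⟨i, l⟩) <;> simp }
  map_one' := by ext1 l; rcases l with _ | ⟨i, l⟩ <;> rfl
  map_mul' v w := by ext1 l; rcases l with _ | ⟨i, l⟩ <;> rfl

@[simp] lemma branch_nil (v : ZMod 3 → Equiv.Perm Tree) : branch v [] = [] := rfl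

@[simp] lemma branch_cons (v : ZMod 3 → Equiv.Perm Tree) (i : ZMod 3) (l : Tree) :
    branch v (i :: l) = i :: v i l := rfl

/-- The `k`-fold rotation of the first level. -/
def rotate (k : ZMod 3) : Equiv.Perm Tree where
  toFun l := match l with
    | [] => []
    | i :: l => (i + k) :: l
  invFun l := match l with
    | [] => []
    | i :: l => (i - k) :: l
  left_inv := by rintro (_ | ⟨i, l⟩) <;> simp
  right_inv := by rintro (_ | ⟨i, l⟩) <;> simp

@[simp] lemma rotate_nil (k : ZMod 3) : rotate k [] = [] := rfl

@[simp] lemma rotate_cons (k i : ZMod 3) (l : Tree) : rotate k (i :: l) = (i + k) :: l := rfl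

lemma rotate_add (j k : ZMod 3) : rotate (j + k) = rotate j * rotate k := by
  ext1 l
  rcases l with _ | ⟨i, l⟩
  · rfl
  · simp [add_assoc, add_comm j k]

lemma rotate_zero : rotate 0 = 1 := by
  ext1 l
  rcases l with _ | ⟨i, l⟩ <;> simp

lemma rotate_neg (k : ZMod 3) : rotate (-k) = (rotate k)⁻¹ := by
  rw [eq_inv_iff_mul_eq_one, ← rotate_add, neg_add_cancel, rotate_zero]

lemma rotate_mul_branch (k : ZMod 3) (v : ZMod 3 → Equiv.Perm Tree) :
    rotate k * branch v = branch (fun x => v (x - k)) * rotate k := by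
  ext1 l
  rcases l with _ | ⟨i, l⟩ <;> simp

/-- The action of the `e`-th power of the second generator of the Gupta-Sidki group. -/
def spineFun (e : ZMod 3) : Tree → Tree
  | [] => []
  | i :: l => i :: if i = 0 then rotate e l else if i = 1 then rotate (-e) l else spineFun e l

lemma spineFun_add (d e : ZMod 3) (l : Tree) :
    spineFun (d + e) l = spineFun d (spineFun e l) := by
  induction l with
  | nil => rfl
  | cons i l ih =>
    simp only [spineFun]
    split_ifs
    · rw [rotate_add]; rfl
    · rw [neg_add, rotate_add]; rfl
    · rw [ih]

lemma spineFun_zero (l : Tree) : spineFun 0 l = l := by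
  induction l with
  | nil => rfl
  | cons i l ih => simp [spineFun, rotate_zero, ih]

/-- The `e`-th power of the second generator of the Gupta-Sidki group. -/
def spine (e : ZMod 3) : Equiv.Perm Tree where
  toFun := spineFun e
  invFun := spineFun (-e)
  left_inv l := by rw [← spineFun_add, neg_add_cancel, spineFun_zero]
  right_inv l := by rw [← spineFun_add, add_neg_cancel, spineFun_zero]

lemma spine_add (d e : ZMod 3) : spine (d + e) = spine d * spine e :=
  Equiv.ext (spineFun_add d e)

lemma spine_zero : spine 0 = 1 := Equiv.ext spineFun_zero

/-- The sections of `spine e`. -/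
def spineSection (e i : ZMod 3) : Equiv.Perm Tree :=
  if i = 0 then rotate e else if i = 1 then rotate (-e) else spine e

lemma spine_eq_branch (e : ZMod 3) : spine e = branch (spineSection e) := by
  ext1 l
  rcases l with _ | ⟨i, l⟩
  · rfl
  · simp only [branch_cons, spineSection]
    change spineFun e _ = _
    simp only [spineFun]
    split_ifs <;> rfl

/-- The conjugate of `spine e` by `rotate i`. -/
def spineConj (i e : ZMod 3) : Equiv.Perm Tree := rotate i * spine e * (rotate i)⁻¹

lemma spineConj_eq_branch (i e : ZMod 3) :
    spineConj i e = branch (fun x => spineSection e (x - i)) := by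
  rw [spineConj, spine_eq_branch, rotate_mul_branch, mul_inv_cancel_right]

lemma spineConj_add (i d e : ZMod 3) : spineConj i (d + e) = spineConj i d * spineConj i e := by
  simp only [spineConj, spine_add]; group

lemma spineConj_zero (i : ZMod 3) : spineConj i 0 = 1 := by simp [spineConj, spine_zero]

lemma spineConj_pow_three (i e : ZMod 3) : spineConj i e ^ 3 = 1 := by
  rw [pow_three, ← spineConj_add, ← spineConj_add]
  have : e + (e + e) = 0 := by revert e; decide
  rw [this, spineConj_zero]

lemma rotate_mul_spineConj (k i e : ZMod 3) :
    rotate k * spineConj i e = spineConj (k + i) e * rotate k := by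
  simp only [spineConj, rotate_add]; group

/-- `IsWord n k g` says that `g` is a product of `n` conjugates `spineConj i e` followed by
`rotate k`. -/
inductive IsWord : ℕ → ZMod 3 → Equiv.Perm Tree → Prop
  | rotate (k : ZMod 3) : IsWord 0 k (rotate k)
  | mul {n : ℕ} {k : ZMod 3} {g : Equiv.Perm Tree} (i e : ZMod 3) (h : IsWord n k g) :
      IsWord (n + 1) k (spineConj i e * g)

lemma IsWord.rotate_mul {n : ℕ} {k : ZMod 3} {g : Equiv.Perm Tree} (h : IsWord n k g)
    (j : ZMod 3) : IsWord n (j + k) (GuptaSidki.rotate j * g) := by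
  induction h with
  | rotate k => rw [← rotate_add]; exact .rotate _
  | mul i e h ih => rw [← mul_assoc, rotate_mul_spineConj, mul_assoc]; exact .mul _ _ ih

lemma IsWord.mul_word {m n : ℕ} {j k : ZMod 3} {g h : Equiv.Perm Tree} (hg : IsWord m j g)
    (hh : IsWord n k h) : IsWord (m + n) (j + k) (g * h) := by
  induction hg with
  | rotate j => rw [zero_add]; exact hh.rotate_mul j
  | mul i e _ ih => rw [mul_assoc, add_right_comm]; exact .mul _ _ ih

lemma IsWord.spine (e : ZMod 3) : IsWord 1 0 (GuptaSidki.spine e) := by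
  have := IsWord.mul 0 e (.rotate 0)
  simpa [spineConj, rotate_zero] using this

/-- A word with trivial rotation fixes the first level; its sections have total length at most
that of the word, and if a single section has full length then the word is a conjugate of a power
of the second generator. -/
lemma IsWord.exists_branch {n : ℕ} {k : ZMod 3} {g : Equiv.Perm Tree} (h : IsWord n k g) :
    ∃ (v : ZMod 3 → Equiv.Perm Tree) (m : ZMod 3 → ℕ) (j : ZMod 3 → ZMod 3),
      g = branch v * GuptaSidki.rotate k ∧ (∀ x, IsWord (m x) (j x) (v x)) ∧
        ∑ x, m x = n ∧ ∑ x, j x = 0 ∧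
        ∀ x, m x = n → ∃ e, branch v = spineConj (x - 2) e := by
  induction h with
  | rotate k =>
    refine ⟨1, 0, 0, by simp, fun x => ?_, by simp, by simp, fun x _ => ⟨0, ?_⟩⟩
    · simpa [rotate_zero] using IsWord.rotate 0
    · rw [spineConj_zero, map_one]
  | @mul n k g i e h ih =>
    obtain ⟨v, m, j, hg, hw, hm, hj, hx⟩ := ih
    have hle : ∀ x, m x ≤ n := fun x => hm ▸ Finset.single_le_sum (fun _ _ => Nat.zero_le _)
      (Finset.mem_univ x)
    refine ⟨fun x => spineSection e (x - i) * v x, fun x => (if x - i = 2 then 1 else 0) + m x,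
      fun x => (if x - i = 0 then e else if x - i = 1 then -e else 0) + j x, ?_, ?_, ?_, ?_, ?_⟩
    · rw [hg, spineConj_eq_branch, ← mul_assoc, ← map_mul]; rfl
    · intro x
      refine IsWord.mul_word ?_ (hw x)
      have h3 : ∀ y : ZMod 3, y = 0 ∨ y = 1 ∨ y = 2 := by decide
      simp only [spineSection]
      rcases h3 (x - i) with h | h | h <;> rw [h]
      · exact .rotate _
      · exact .rotate _
      · exact .spine _
    · rw [Finset.sum_add_distrib, hm, add_comm]
      congr 1
      revert i; decide
    · rw [Finset.sum_add_distrib, hj, add_zero]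
      revert i e; decide
    · intro x hxn
      have h2 : x - i = 2 := by
        by_contra h2
        have := hle x
        simp only [h2, if_false] at hxn
        omega
      simp only [h2, if_true] at hxn
      obtain ⟨d, hd⟩ := hx x (by omega)
      have hi : x - 2 = i := by rw [← h2]; ring
      refine ⟨e + d, ?_⟩
      rw [spineConj_add, ← hd, hi, spineConj_eq_branch, ← map_mul]; rfl

lemma isOfFinOrder_branch {v : ZMod 3 → Equiv.Perm Tree} (h : ∀ x, IsOfFinOrder (v x)) :
    IsOfFinOrder (branch v) :=
  branch.isOfFinOrder (by
    rw [isOfFinOrder_iff_pow_eq_one]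
    refine ⟨∏ x, orderOf (v x), Finset.prod_pos fun x _ => (h x).orderOf_pos, ?_⟩
    ext1 x
    exact orderOf_dvd_iff_pow_eq_one.1 (Finset.dvd_prod_of_mem _ (Finset.mem_univ x)))

lemma sum_eq_of_ne_zero {M : Type*} [AddCommMonoid M] {k : ZMod 3} (hk : k ≠ 0) (f : ZMod 3 → M)
    (x : ZMod 3) : f x + (f (x - k) + f (x - k - k)) = ∑ y, f y := by
  have hu : (Finset.univ : Finset (ZMod 3)) = {x, x - k, x - k - k} := by
    revert k x; decide
  rw [hu, Finset.sum_insert, Finset.sum_insert, Finset.sum_singleton]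
  all_goals revert k x; decide

lemma IsWord.isOfFinOrder {n : ℕ} : ∀ {k : ZMod 3} {g : Equiv.Perm Tree}, IsWord n k g →
    IsOfFinOrder g := by
  induction n using Nat.strong_induction_on with
  | _ n ih =>
  have key : ∀ g, IsWord n 0 g → IsOfFinOrder g := by
    intro g hg
    obtain ⟨v, m, j, rfl, hw, hm, -, hx⟩ := hg.exists_branch
    rw [rotate_zero, mul_one]
    by_cases hn : ∃ x, m x = n
    · obtain ⟨x, hxn⟩ := hn
      obtain ⟨e, he⟩ := hx x hxn
      rw [he, isOfFinOrder_iff_pow_eq_one]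
      exact ⟨3, by norm_num, spineConj_pow_three _ _⟩
    · push Not at hn
      refine isOfFinOrder_branch fun x => ih (m x) (lt_of_le_of_ne ?_ (hn x)) (hw x)
      exact hm ▸ Finset.single_le_sum (fun _ _ => Nat.zero_le _) (Finset.mem_univ x)
  intro k g hg
  by_cases hk : k = 0
  · exact key g (hk ▸ hg)
  obtain ⟨v, m, j, rfl, hw, hm, hj, -⟩ := hg.exists_branch
  have hcube : (branch v * GuptaSidki.rotate k) ^ 3
      = branch (fun x => v x * (v (x - k) * v (x - k - k))) := by
    have h3 : GuptaSidki.rotate k * (GuptaSidki.rotate k * GuptaSidki.rotate k) = 1 := by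
      rw [← rotate_add, ← rotate_add, ← rotate_zero]
      congr 1
      exact (by decide : ∀ k : ZMod 3, k + (k + k) = 0) k
    have e1 : (fun x => v x * (v (x - k) * v (x - k - k)))
      = v * ((fun x => v (x - k)) * fun x => v (x - k - k)) := rfl
    have h1 := rotate_mul_branch k v
    have h2 := rotate_mul_branch k (fun x => v (x - k))
    rw [e1, map_mul, map_mul]
    generalize GuptaSidki.rotate k = r at *
    calc (branch v * r) ^ 3 = branch v * (r * branch v) * (r * branch v) * r := by
          rw [pow_three]; group
      _ = branch v * branch (fun x => v (x - k)) * (r * (branch fun x => v (x - k))) * r * r := by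
          rw [h1]; group
      _ = branch v * (branch (fun x => v (x - k)) * branch fun x => v (x - k - k))
            * (r * (r * r)) := by rw [h2]; group
      _ = _ := by rw [h3, mul_one]
  have hfin : IsOfFinOrder ((branch v * GuptaSidki.rotate k) ^ 3) := by
    rw [hcube]
    refine isOfFinOrder_branch fun x => key _ ?_
    have := (hw x).mul_word ((hw (x - k)).mul_word (hw (x - k - k)))
    rwa [sum_eq_of_ne_zero hk m, sum_eq_of_ne_zero hk j, hm, hj] at this
  exact (isOfFinOrder_pow.1 hfin).resolve_right (by norm_num)

end GuptaSidki

/-- The Gupta-Sidki `3`-group. -/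
def guptaSidki : Subgroup (Equiv.Perm GuptaSidki.Tree) :=
  Subgroup.closure {GuptaSidki.rotate 1, GuptaSidki.spine 1}

namespace GuptaSidki

lemma rotate_mem (k : ZMod 3) : rotate k ∈ guptaSidki := by
  have h1 : rotate 1 ∈ guptaSidki := Subgroup.subset_closure (by simp)
  have h3 : ∀ y : ZMod 3, y = 0 ∨ y = 1 ∨ y = 1 + 1 := by decide
  rcases h3 k with rfl | rfl | rfl
  · rw [rotate_zero]; exact one_mem _
  · exact h1
  · rw [rotate_add]; exact mul_mem h1 h1

lemma spine_mem : spine 1 ∈ guptaSidki := Subgroup.subset_closure (by simp)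

lemma exists_isWord {g : Equiv.Perm Tree} (hg : g ∈ guptaSidki) : ∃ n k, IsWord n k g := by
  induction hg using Subgroup.closure_induction'' with
  | one => exact ⟨0, 0, rotate_zero ▸ .rotate 0⟩
  | mem x hx =>
    rcases hx with rfl | rfl
    · exact ⟨0, 1, .rotate 1⟩
    · exact ⟨1, 0, .spine 1⟩
  | inv_mem x hx =>
    rcases hx with rfl | rfl
    · exact ⟨0, -1, rotate_neg 1 ▸ .rotate (-1)⟩
    · refine ⟨1, 0, ?_⟩
      have : (spine 1)⁻¹ = spine (-1) := rfl
      exact this ▸ .spine (-1)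
  | mul x y _ _ hx hy =>
    obtain ⟨m, j, hx⟩ := hx
    obtain ⟨n, k, hy⟩ := hy
    exact ⟨_, _, hx.mul_word hy⟩

lemma isOfFinOrder (g : guptaSidki) : IsOfFinOrder g := by
  obtain ⟨n, k, h⟩ := exists_isWord g.2
  exact Submonoid.isOfFinOrder_coe.1 h.isOfFinOrder

lemma exists_branch_mem {g : Equiv.Perm Tree} (hg : g ∈ guptaSidki) :
    ∃ v, branch v ∈ guptaSidki ∧ v 0 = g := by
  induction hg using Subgroup.closure_induction with
  | one => exact ⟨1, by rw [map_one]; exact one_mem _, rfl⟩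
  | mem x hx =>
    rcases hx with rfl | rfl
    · exact ⟨_, spine_eq_branch 1 ▸ spine_mem, rfl⟩
    · refine ⟨fun x => spineSection 1 (x - 1), ?_, rfl⟩
      rw [← spineConj_eq_branch]
      exact mul_mem (mul_mem (rotate_mem 1) spine_mem) (inv_mem (rotate_mem 1))
  | inv x _ h =>
    obtain ⟨v, hv, rfl⟩ := h
    exact ⟨v⁻¹, by rw [map_inv]; exact inv_mem hv, rfl⟩
  | mul x y _ _ hx hy =>
    obtain ⟨v, hv, rfl⟩ := hx
    obtain ⟨w, hw, rfl⟩ := hy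
    exact ⟨v * w, by rw [map_mul]; exact mul_mem hv hw, rfl⟩

instance : Infinite guptaSidki := by
  rw [← not_finite_iff_infinite]
  intro hfin
  choose v hv hv0 using fun g : guptaSidki => exists_branch_mem g.2
  let s : guptaSidki → guptaSidki := fun g => ⟨branch (v g), hv g⟩
  have hs : Function.Injective s := by
    intro g h hgh
    refine Subtype.ext (Equiv.ext fun l => ?_)
    have := DFunLike.congr_fun (congrArg Subtype.val hgh) (0 :: l)
    simpa [s, hv0] using this
  obtain ⟨g, hg⟩ := Finite.surjective_of_injective hs ⟨rotate 1, rotate_mem 1⟩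
  have := DFunLike.congr_fun (congrArg Subtype.val hg) [0]
  simp [s] at this

instance : Group.FG guptaSidki :=
  (Group.fg_iff_subgroup_fg _).2 ((Subgroup.fg_iff _).2 ⟨_, rfl, by simp⟩)

end GuptaSidki

/-- A witness that `g` is distorted and is a commutator and a product of involutions: every power
`g ^ k ^ 2` is a commutator of a word of length linear in `k` with the product of the two
involutions `r` and `s`. -/
structure DistortionWitness {P : Type*} [Group P] (g f t r s : P) : Prop where
  r_sq : r ^ 2 = 1
  s_sq : s ^ 2 = 1
  pow_sq : ∀ k : ℕ, g ^ k ^ 2 = ⁅t ^ k * f * (t ^ k)⁻¹, r * s⁆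

/-- A group is self-distorted if each of its elements has a distortion witness. -/
def SelfDistorted (P : Type*) [Group P] : Prop :=
  ∀ g : P, ∃ f t r s : P, DistortionWitness g f t r s

namespace DistortionWitness

variable {P K : Type*} [Group P] [Group K]

lemma map {g f t r s : P} (h : DistortionWitness g f t r s) (φ : P →* K) :
    DistortionWitness (φ g) (φ f) (φ t) (φ r) (φ s) where
  r_sq := by rw [← map_pow, h.r_sq, map_one]
  s_sq := by rw [← map_pow, h.s_sq, map_one]
  pow_sq k := by
    rw [← map_pow, h.pow_sq, map_commutatorElement]
    simp only [map_mul, map_inv, map_pow]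

lemma of_map {φ : P →* K} (hφ : Function.Injective φ) {g f t r s : P}
    (h : DistortionWitness (φ g) (φ f) (φ t) (φ r) (φ s)) : DistortionWitness g f t r s where
  r_sq := hφ (by rw [map_pow, h.r_sq, map_one])
  s_sq := hφ (by rw [map_pow, h.s_sq, map_one])
  pow_sq k := hφ (by
    rw [map_pow, h.pow_sq, map_commutatorElement]
    simp only [map_mul, map_inv, map_pow])

lemma eq_commutator {g f t r s : P} (h : DistortionWitness g f t r s) :
    g = ⁅t * f * t⁻¹, r * s⁆ := by
  simpa using h.pow_sq 1

lemma mem_closure_involutions {g f t r s : P} (h : DistortionWitness g f t r s) :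
    g ∈ Subgroup.closure {x : P | x ^ 2 = 1} := by
  have key : ∀ u x : P, x ^ 2 = 1 → u * x * u⁻¹ ∈ Subgroup.closure {x : P | x ^ 2 = 1} :=
    fun u x hx => Subgroup.subset_closure (show (u * x * u⁻¹) ^ 2 = 1 by simp [conj_pow, hx])
  have hr : r ∈ Subgroup.closure {x : P | x ^ 2 = 1} := Subgroup.subset_closure h.r_sq
  have hs : s ∈ Subgroup.closure {x : P | x ^ 2 = 1} := Subgroup.subset_closure h.s_sq
  have hg : g = (t * f * t⁻¹) * r * (t * f * t⁻¹)⁻¹ * ((t * f * t⁻¹) * s * (t * f * t⁻¹)⁻¹)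
      * (r * s)⁻¹ := by
    rw [h.eq_commutator, commutatorElement_def]; group
  rw [hg]
  exact mul_mem (mul_mem (key _ r h.r_sq) (key _ s h.s_sq)) (inv_mem (mul_mem hr hs))

end DistortionWitness

/-- A family of permutations of `α`, indexed by `β`, acts on `α × β` fibrewise. -/
def fiberPerm (α β : Type*) : (β → Equiv.Perm α) →* Equiv.Perm (α × β) where
  toFun := Equiv.prodCongrLeft
  map_one' := rfl
  map_mul' _ _ := rfl

@[simp] lemma fiberPerm_apply {α β : Type*} (v : β → Equiv.Perm α) (x : α × β) :
    fiberPerm α β v x = (v x.2 x.1, x.2) := rfl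

namespace DistortionWitness

/-- The translation in the first direction of the plane. -/
def shift (α : Type*) : Equiv.Perm (α × ℤ × ℤ) :=
  (Equiv.refl α).prodCongr ((Equiv.addRight 1).prodCongr (Equiv.refl ℤ))

/-- The reflection `j ↦ c - j` on the column through the origin of the plane. -/
def columnReflection (α : Type*) (c : ℤ) : Equiv.Perm (α × ℤ × ℤ) :=
  Function.Involutive.toPerm (fun x => (x.1, x.2.1, if x.2.1 = 0 then c - x.2.2 else x.2.2)) (by
    rintro ⟨a, i, j⟩
    by_cases hi : i = 0 <;> simp [hi])

/-- The permutation acting as `h ^ (i - c) ^ 2` over the point `(i, j)` of the upper half-plane. -/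
def squarePowers {α : Type*} (h : Equiv.Perm α) (c : ℤ) : Equiv.Perm (α × ℤ × ℤ) :=
  fiberPerm α (ℤ × ℤ) fun p => if 0 ≤ p.2 then h ^ ((p.1 - c) ^ 2) else 1

lemma shift_conj_squarePowers {α : Type*} (h : Equiv.Perm α) (c : ℤ) :
    shift α * squarePowers h c * (shift α)⁻¹ = squarePowers h (c + 1) := by
  rw [mul_inv_eq_iff_eq_mul]
  ext1 ⟨a, i, j⟩
  simp [shift, squarePowers]

lemma shift_pow_conj_squarePowers {α : Type*} (h : Equiv.Perm α) (k : ℕ) :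
    shift α ^ k * squarePowers h 0 * (shift α ^ k)⁻¹ = squarePowers h k := by
  induction k with
  | zero => simp
  | succ k ih =>
    rw [Nat.cast_succ, ← shift_conj_squarePowers, ← ih, pow_succ']
    group

/-- A permutation supported over the origin of the plane has a distortion witness. -/
lemma fiberPerm_ite {α : Type*} (h : Equiv.Perm α) :
    DistortionWitness (fiberPerm α (ℤ × ℤ) fun p => if p = 0 then h else 1)
      (squarePowers h 0) (shift α) (columnReflection α 1) (columnReflection α 0) where
  r_sq := by ext1 x; exact (columnReflection α 1).left_inv x
  s_sq := by ext1 x; exact (columnReflection α 0).left_inv x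
  pow_sq k := by
    have hpow : (fiberPerm α (ℤ × ℤ) fun p => if p = 0 then h else 1) ^ k ^ 2
        = fiberPerm α (ℤ × ℤ) fun p => if p = 0 then h ^ k ^ 2 else 1 := by
      rw [← map_pow]
      congr 1
      ext1 p
      simp only [Pi.pow_apply, ite_pow, one_pow]
    rw [shift_pow_conj_squarePowers, commutatorElement_def, eq_mul_inv_iff_mul_eq,
      eq_mul_inv_iff_mul_eq, hpow]
    ext1 ⟨a, i, j⟩
    by_cases hi : i = 0
    · subst hi
      rcases lt_trichotomy j (-1) with hj | rfl | hj
      · have h0 : ¬ 0 ≤ j := by omega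
        have h1 : ¬ 0 ≤ 1 + j := by omega
        have h2 : ¬ 1 + j = 0 := by omega
        simp [squarePowers, columnReflection, Function.Involutive.toPerm, h0, h1, h2]
      · simp [squarePowers, columnReflection, Function.Involutive.toPerm]
        rfl
      · have h0 : 0 ≤ j := by omega
        have h1 : 0 ≤ 1 + j := by omega
        have h2 : ¬ 1 + j = 0 := by omega
        simp [squarePowers, columnReflection, Function.Involutive.toPerm, h0, h1, h2]
    · simp [squarePowers, columnReflection, Function.Involutive.toPerm, hi]

end DistortionWitness

/-- The permutations of `Ω` moving only countably many points. -/
def countablySupported (Ω : Type*) : Subgroup (Equiv.Perm Ω) where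
  carrier := {g | {x | g x ≠ x}.Countable}
  one_mem' := by simp
  mul_mem' {g h} hg hh := by
    refine (Set.Countable.union hg hh).mono fun x hx => ?_
    by_contra hx'
    simp only [Set.mem_union, Set.mem_ofPred_eq, not_or, not_not] at hx'
    exact hx (by rw [Equiv.Perm.mul_apply, hx'.2, hx'.1])
  inv_mem' {g} hg := by
    refine Set.Countable.mono (fun x hx => ?_) hg
    intro hx'
    exact hx (Equiv.Perm.inv_eq_iff_eq.2 hx'.symm)

lemma viaEmbedding_mem_countablySupported {α Ω : Type*} [Countable α] (ι : α ↪ Ω)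
    (e : Equiv.Perm α) : Equiv.Perm.viaEmbeddingHom ι e ∈ countablySupported Ω := by
  refine (Set.countable_range ι).mono fun x hx => ?_
  by_contra hx'
  exact hx (Equiv.Perm.viaEmbedding_apply_of_notMem e ι x hx')

/-- Every countably supported permutation of an uncountable set comes from a permutation of
`α × ℤ × ℤ` supported over the origin of the plane, for some countable `α`. -/
lemma exists_eq_viaEmbedding_fiberPerm {Ω : Type*} [Uncountable Ω] {g : Equiv.Perm Ω}
    (hg : g ∈ countablySupported Ω) :
    ∃ (A : Set Ω) (_ : Countable A) (h : Equiv.Perm A) (ι : A × ℤ × ℤ ↪ Ω),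
      Equiv.Perm.viaEmbeddingHom ι (fiberPerm A (ℤ × ℤ) fun p => if p = 0 then h else 1) = g := by
  classical
  let A : Set Ω := {x | g x ≠ x}
  have hA : A.Countable := hg
  have hA' : Countable A := hA
  have : Infinite (Aᶜ : Set Ω) :=
    (Set.Infinite.to_subtype fun hfin => Set.not_countable_univ
      (by rw [← Set.union_compl_self A]; exact hA.union hfin.countable))
  obtain ⟨n⟩ := nonempty_embedding_nat (A × ℤ × ℤ)
  let e : A × ℤ × ℤ ↪ (Aᶜ : Set Ω) := n.trans (Infinite.natEmbedding _)
  let ι : A × ℤ × ℤ ↪ Ω := ⟨fun x => if x.2 = 0 then x.1 else e x, by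
    intro x y hxy
    by_cases hx : x.2 = 0 <;> by_cases hy : y.2 = 0 <;> simp only [hx, hy, if_true, if_false] at hxy
    · exact Prod.ext (Subtype.ext hxy) (hx.trans hy.symm)
    · exact absurd x.1.2 (hxy ▸ (e y).2)
    · exact absurd y.1.2 (hxy ▸ (e x).2)
    · exact e.injective (Subtype.ext hxy)⟩
  have hι : ∀ a : A, ι (a, 0) = a := fun a =>
    if_pos (c := (0 : ℤ × ℤ) = 0) (t := (a : Ω)) (e := e (a, 0)) rfl
  let h : Equiv.Perm A := g.subtypePerm fun x => by simp [A]
  refine ⟨A, hA', h, ι, ?_⟩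
  ext1 x
  by_cases hx : x ∈ Set.range ι
  · obtain ⟨y, rfl⟩ := hx
    rw [Equiv.Perm.viaEmbeddingHom_apply, Equiv.Perm.viaEmbedding_apply]
    obtain ⟨a, p⟩ := y
    by_cases hp : p = 0
    · subst hp
      simp only [fiberPerm_apply, if_true, hι]
      rfl
    · have h1 : ι (a, p) = e (a, p) := if_neg hp
      have h2 : ι (a, p) ∉ A := h1 ▸ (e (a, p)).2
      simp only [A, Set.mem_ofPred_eq, not_not] at h2
      simp [hp, h2]
  · rw [Equiv.Perm.viaEmbeddingHom_apply, Equiv.Perm.viaEmbedding_apply_of_notMem _ _ _ hx]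
    by_contra hgx
    have hxA : x ∈ A := fun h => hgx h.symm
    exact hx ⟨(⟨x, hxA⟩, 0), hι _⟩

lemma selfDistorted_countablySupported (Ω : Type*) [Uncountable Ω] :
    SelfDistorted (countablySupported Ω) := by
  rintro ⟨g, hg⟩
  obtain ⟨A, _, h, ι, rfl⟩ := exists_eq_viaEmbedding_fiberPerm hg
  exact ⟨_, _, _, _, (DistortionWitness.fiberPerm_ite h).map
    ((Equiv.Perm.viaEmbeddingHom ι).codRestrict
    (countablySupported Ω) (viaEmbedding_mem_countablySupported ι))⟩

lemma countable_closure {P : Type*} [Group P] {S : Set P} (hS : S.Countable) :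
    (Subgroup.closure S : Set P).Countable := by
  have : Countable S := hS
  have : Countable (FreeGroup S) := inferInstance
  rw [← Subtype.range_coe (s := S), ← FreeGroup.range_lift_eq_closure]
  exact Set.countable_range _

/-- A countable subset lies in a countable subgroup closed under a given countable family of
operations. -/
lemma exists_countable_subgroup_closed {P ι : Type*} [Group P] [Countable ι] {S : Set P}
    (hS : S.Countable) (φ : ι → P → P) :
    ∃ K : Subgroup P, (K : Set P).Countable ∧ S ⊆ K ∧ ∀ i, ∀ x ∈ K, φ i x ∈ K := by
  let step : Subgroup P → Subgroup P := fun K => Subgroup.closure (K ∪ ⋃ i, φ i '' K)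
  let K : ℕ → Subgroup P := fun n => step^[n] (Subgroup.closure S)
  have hK : ∀ n, K (n + 1) = step (K n) := fun n => Function.iterate_succ_apply' _ _ _
  have hmono : Monotone K := monotone_nat_of_le_succ fun n => by
    rw [hK]
    exact fun x hx => Subgroup.subset_closure (Or.inl hx)
  have hcount : ∀ n, (K n : Set P).Countable := by
    intro n
    induction n with
    | zero => exact countable_closure hS
    | succ n ih =>
      rw [hK]
      exact countable_closure (ih.union (Set.countable_iUnion fun i => ih.image _))
  refine ⟨⨆ n, K n, ?_, ?_, ?_⟩
  · rw [Subgroup.coe_iSup_of_directed hmono.directed_le]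
    exact Set.countable_iUnion hcount
  · exact Subgroup.subset_closure.trans (le_iSup K 0)
  · intro i x hx
    obtain ⟨n, hn⟩ := (Subgroup.mem_iSup_of_directed hmono.directed_le).1 hx
    refine le_iSup K (n + 1) ?_
    rw [hK]
    exact Subgroup.subset_closure (Or.inr (Set.mem_iUnion.2 ⟨i, Set.mem_image_of_mem _ hn⟩))

/-- Every countable group embeds into a countable self-distorted group. -/
lemma exists_countable_selfDistorted (G : Type uG) [Group G] [Countable G] :
    ∃ (H : Type uG) (_ : Group H) (_ : Countable H) (φ : G →* H),
      Function.Injective φ ∧ SelfDistorted H := by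
  let Ω : Type _ := G × ℝ
  have : Uncountable Ω := Prod.snd_surjective.uncountable
  let ι : G ↪ Ω := ⟨fun g => (g, 0), fun g h hgh => congrArg Prod.fst hgh⟩
  let φ : G →* countablySupported Ω :=
    ((Equiv.Perm.viaEmbeddingHom ι).codRestrict (countablySupported Ω)
      (viaEmbedding_mem_countablySupported ι)).comp (MulAction.toPermHom G G)
  have hφ : Function.Injective φ := fun g h hgh =>
    MulAction.toPerm_injective (Equiv.Perm.viaEmbeddingHom_injective ι (congrArg Subtype.val hgh))
  choose f t r s hw using selfDistorted_countablySupported Ω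
  obtain ⟨K, hK, hφK, hcl⟩ :=
    exists_countable_subgroup_closed (Set.countable_range φ) ![f, t, r, s]
  have hKc : Countable K := hK
  refine ⟨K, inferInstance, hKc, φ.codRestrict K fun g => hφK ⟨g, rfl⟩, ?_, ?_⟩
  · exact fun g h hgh => hφ (congrArg Subtype.val hgh)
  · intro g
    exact ⟨⟨_, hcl 0 g g.2⟩, ⟨_, hcl 1 g g.2⟩, ⟨_, hcl 2 g g.2⟩, ⟨_, hcl 3 g g.2⟩,
      .of_map K.subtype_injective (hw g)⟩

/-- A length function on a group: nonnegative, subadditive and symmetric. -/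
structure IsLength {C : Type*} [Group C] (ℓ : C → ℝ) : Prop where
  nonneg : ∀ g, 0 ≤ ℓ g
  mul_le : ∀ g h, ℓ (g * h) ≤ ℓ g + ℓ h
  inv : ∀ g, ℓ g⁻¹ = ℓ g

namespace IsLength

variable {C : Type*} [Group C] {ℓ : C → ℝ}

lemma pow_le (hℓ : IsLength ℓ) (g : C) (n : ℕ) : ℓ (g ^ n) ≤ n * ℓ g + ℓ 1 := by
  induction n with
  | zero => simp
  | succ n ih =>
    rw [pow_succ]
    have := hℓ.mul_le (g ^ n) g
    push_cast
    linarith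

lemma conj_le (hℓ : IsLength ℓ) (g h : C) : ℓ (g * h * g⁻¹) ≤ 2 * ℓ g + ℓ h := by
  have h1 := hℓ.mul_le (g * h) g⁻¹
  have h2 := hℓ.mul_le g h
  rw [hℓ.inv] at h1
  linarith

lemma commutator_le (hℓ : IsLength ℓ) (g h : C) : ℓ ⁅g, h⁆ ≤ 2 * ℓ g + 2 * ℓ h := by
  rw [commutatorElement_def]
  have h1 := hℓ.mul_le (g * h * g⁻¹) h⁻¹
  have h2 := hℓ.conj_le g h
  rw [hℓ.inv] at h1
  linarith

end IsLength

/-- An element is sublinear for a length function if the lengths of its powers grow sublinearly. -/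
def IsSublinear {C : Type*} [Group C] (ℓ : C → ℝ) (g : C) : Prop :=
  ∀ ε : ℝ, 0 < ε → ∃ B : ℝ, ∀ n : ℕ, ℓ (g ^ n) ≤ ε * n + B

namespace IsSublinear

variable {C : Type*} [Group C] {ℓ : C → ℝ}

lemma one (ℓ : C → ℝ) : IsSublinear ℓ 1 := fun ε hε =>
  ⟨ℓ 1, fun n => by rw [one_pow]; exact le_add_of_nonneg_left (by positivity)⟩

lemma mul_of_commute (hℓ : IsLength ℓ) {g h : C} (hg : IsSublinear ℓ g) (hh : IsSublinear ℓ h)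
    (hgh : Commute g h) : IsSublinear ℓ (g * h) := by
  intro ε hε
  obtain ⟨B, hB⟩ := hg (ε / 2) (half_pos hε)
  obtain ⟨B', hB'⟩ := hh (ε / 2) (half_pos hε)
  refine ⟨B + B', fun n => ?_⟩
  rw [hgh.mul_pow]
  linarith [hℓ.mul_le (g ^ n) (h ^ n), hB n, hB' n]

lemma of_pow (hℓ : IsLength ℓ) {g : C} {m : ℕ} (hm : 0 < m) (hg : IsSublinear ℓ (g ^ m)) :
    IsSublinear ℓ g := by
  intro ε hε
  obtain ⟨B, hB⟩ := hg ε hε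
  refine ⟨B + (m * ℓ g + ℓ 1), fun n => ?_⟩
  have h1 := hℓ.mul_le ((g ^ m) ^ (n / m)) (g ^ (n % m))
  rw [← pow_mul, ← pow_add, Nat.div_add_mod] at h1
  have h2 := hB (n / m)
  rw [← pow_mul] at h2
  have h3 := hℓ.pow_le g (n % m)
  have h4 : ((n / m : ℕ) : ℝ) ≤ n := Nat.cast_le.2 (Nat.div_le_self n m)
  have h5 : ((n % m : ℕ) : ℝ) ≤ m := Nat.cast_le.2 (Nat.mod_lt n hm).le
  have h6 := mul_le_mul_of_nonneg_left h4 hε.le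
  have h7 := mul_le_mul_of_nonneg_right h5 (hℓ.nonneg g)
  linarith

end IsSublinear

lemma DistortionWitness.isSublinear {C : Type*} [Group C] {ℓ : C → ℝ} (hℓ : IsLength ℓ)
    {g f t r s : C} (h : DistortionWitness g f t r s) : IsSublinear ℓ g := by
  intro ε hε
  set c : ℝ := 4 * ℓ t + 2 * ℓ g with hc
  have hc0 : 0 ≤ c := by have := hℓ.nonneg t; have := hℓ.nonneg g; positivity
  refine ⟨c ^ 2 / (4 * ε) + (5 * ℓ 1 + 2 * ℓ f + 2 * ℓ (r * s)), fun n => ?_⟩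
  obtain ⟨k, j, hj, hjk⟩ : ∃ k j, n = k ^ 2 + j ∧ j ≤ 2 * k := by
    refine ⟨n.sqrt, n - n.sqrt ^ 2, ?_, ?_⟩
    · have := Nat.sqrt_le' n
      omega
    · have := Nat.sqrt_le_add n
      rw [sq]
      omega
  have h1 := hℓ.mul_le (g ^ k ^ 2) (g ^ j)
  rw [← pow_add, ← hj, h.pow_sq] at h1
  have h2 := hℓ.commutator_le (t ^ k * f * (t ^ k)⁻¹) (r * s)
  have h3 := hℓ.conj_le (t ^ k) f
  have h4 := hℓ.pow_le t k
  have h5 := hℓ.pow_le g j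
  have h6 : (j : ℝ) ≤ 2 * k := by exact_mod_cast hjk
  have h7 := mul_le_mul_of_nonneg_right h6 (hℓ.nonneg g)
  have h8 : (k : ℝ) ^ 2 ≤ n := by rw [hj]; push_cast; linarith [(Nat.cast_nonneg j : (0 : ℝ) ≤ j)]
  have h9 : c * k ≤ ε * k ^ 2 + c ^ 2 / (4 * ε) := by
    have : ε * k ^ 2 + c ^ 2 / (4 * ε) - c * k = (2 * ε * k - c) ^ 2 / (4 * ε) := by
      field_simp; ring
    have : 0 ≤ (2 * ε * k - c) ^ 2 / (4 * ε) := by positivity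
    linarith
  have h10 := mul_le_mul_of_nonneg_left h8 hε.le
  rw [hc] at h9
  rw [hc]
  linarith

/-- A sequence in a group is sparse if no term is of the form `x * y⁻¹ * z` with `x`, `y`, `z` among
the earlier terms. -/
def IsSparse {Q : Type*} [Group Q] (z : ℕ → Q) : Prop :=
  ∀ n, ∀ i < n, ∀ j < n, ∀ k < n, z n ≠ z i * (z j)⁻¹ * z k

lemma exists_isSparse (Q : Type*) [Group Q] [Infinite Q] : ∃ z : ℕ → Q, IsSparse z := by
  classical
  choose new h_new using fun s : Finset Q =>
    Infinite.exists_notMem_finset ((s ×ˢ s ×ˢ s).image fun p => p.1 * p.2.1⁻¹ * p.2.2)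
  let s : ℕ → Finset Q := fun n => Nat.rec ∅ (fun _ t => insert (new t) t) n
  have h_succ : ∀ n, s (n + 1) = insert (new (s n)) (s n) := fun _ => rfl
  have h_mem : ∀ {i n}, i < n → new (s i) ∈ s n := by
    intro i n hin
    induction n with
    | zero => omega
    | succ n ih =>
      rw [h_succ, Finset.mem_insert]
      rcases Nat.lt_succ_iff_lt_or_eq.1 hin with h | rfl
      · exact Or.inr (ih h)
      · exact Or.inl rfl
  refine ⟨fun n => new (s n), fun n i hi j hj k hk h => h_new (s n) (Finset.mem_image.2 ?_)⟩
  exact ⟨(new (s i), new (s j), new (s k)), by simp [h_mem hi, h_mem hj, h_mem hk], h.symm⟩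

namespace IsSparse

variable {Q : Type*} [Group Q] {z : ℕ → Q}

lemma injective (hz : IsSparse z) : Function.Injective z := by
  have key : ∀ i n, i < n → z n ≠ z i := fun i n hin h => hz n i hin i hin i hin (by simp [h])
  intro m n h
  rcases lt_trichotomy m n with hmn | hmn | hmn
  · exact (key m n hmn h.symm).elim
  · exact hmn
  · exact (key n m hmn h).elim

lemma finite_overlap (hz : IsSparse z) {g : Q} (hg : g ≠ 1) :
    {x | x ∈ Set.range z ∧ g * x ∈ Set.range z}.Finite := by
  have h_ne : ∀ {m n}, z m = g * z n → m ≠ n := by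
    rintro m _ h rfl
    exact hg (by simpa using h.symm)
  rcases Set.eq_empty_or_nonempty {x | x ∈ Set.range z ∧ g * x ∈ Set.range z} with h | h
  · rw [h]; exact Set.finite_empty
  obtain ⟨_, ⟨n, rfl⟩, m, hm⟩ := h
  refine ((Set.finite_Iic (max n m)).image z).subset ?_
  rintro _ ⟨⟨n', rfl⟩, m', hm'⟩
  refine ⟨n', ?_, rfl⟩
  by_contra h_lt
  rw [Set.mem_Iic, not_le, max_lt_iff] at h_lt
  have hg' : g = z m * (z n)⁻¹ := by rw [hm]; group
  have hne := h_ne hm'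
  rcases lt_or_gt_of_ne hne with h | h
  · refine hz n' n h_lt.1 m h_lt.2 m' h ?_
    rw [hm', hg']; group
  · refine hz m' m (h_lt.2.trans h) n (h_lt.1.trans h) n' h ?_
    rw [hm', hg']

lemma eq_of_quotient_eq (hz : IsSparse z) {a b c d : ℕ} (hab : a ≠ b) (had : a ≠ d) (hcb : c ≠ b)
    (hcd : c ≠ d) (h : (z a)⁻¹ * z c = (z b)⁻¹ * z d) : a = c := by
  by_contra hac
  have hbd : b ≠ d := by
    rintro rfl
    rw [inv_mul_cancel, inv_mul_eq_one] at h
    exact hac (hz.injective h)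
  have ha : z a = z c * (z d)⁻¹ * z b := by
    rw [mul_assoc, ← inv_inv ((z d)⁻¹ * z b), mul_inv_rev, inv_inv, ← h]; group
  have hc : z c = z a * (z b)⁻¹ * z d := by rw [mul_assoc, ← h]; group
  have hb : z b = z d * (z c)⁻¹ * z a := by rw [ha]; group
  have hd : z d = z b * (z a)⁻¹ * z c := by rw [mul_assoc, h]; group
  have h_max : (c < a ∧ d < a ∧ b < a) ∨ (a < c ∧ b < c ∧ d < c) ∨ (d < b ∧ c < b ∧ a < b) ∨
      (b < d ∧ a < d ∧ c < d) := by omega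
  rcases h_max with ⟨h1, h2, h3⟩ | ⟨h1, h2, h3⟩ | ⟨h1, h2, h3⟩ | ⟨h1, h2, h3⟩
  · exact hz _ _ h1 _ h2 _ h3 ha
  · exact hz _ _ h1 _ h2 _ h3 hc
  · exact hz _ _ h1 _ h2 _ h3 hb
  · exact hz _ _ h1 _ h2 _ h3 hd

end IsSparse

/-- A pair of functions from a group `Q` to the involutions of a group `H`, almost all of whose
translates commute at a given point, and such that any two involutions are the only values of
translates of the two functions that meet at a single point. -/
structure SparsePair {Q H : Type*} [Group Q] [Group H] (f : Bool → Q → H) : Prop where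
  sq : ∀ b x, f b x ^ 2 = 1
  commute : ∀ b c g, ∀ᶠ x in Filter.cofinite, Commute (f b x) (f c (g * x))
  meet : ∀ h k : H, h ^ 2 = 1 → k ^ 2 = 1 → ∃ x y, f true x = h ∧ f false y = k ∧
    ∀ u, u ≠ 1 → f true (x * u) = 1 ∨ f false (y * u) = 1

lemma exists_sparsePair (Q H : Type*) [Group Q] [Infinite Q] [Group H] [Countable H] :
    ∃ f : Bool → Q → H, SparsePair f := by
  obtain ⟨z, hz⟩ := exists_isSparse Q
  obtain ⟨h, h_range⟩ := (Set.to_countable {x : H | x ^ 2 = 1}).exists_eq_range ⟨1, one_pow 2⟩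
  have h_sq : ∀ n, h n ^ 2 = 1 := fun n => by
    have : h n ∈ {x : H | x ^ 2 = 1} := h_range ▸ Set.mem_range_self n
    exact this
  let e : Bool → ℕ → Q := fun b n => z (2 * n + b.toNat)
  have he : ∀ b, Function.Injective (e b) := fun b m n hmn => by
    have := hz.injective hmn
    omega
  let f : Bool → Q → H := fun b => Function.extend (e b) h 1
  have hf : ∀ b n, f b (e b n) = h n := fun b n => (he b).extend_apply _ _ _
  have hf' : ∀ b x, f b x = 1 ∨ ∃ n, e b n = x := fun b x => by
    by_cases hx : ∃ n, e b n = x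
    · exact Or.inr hx
    · exact Or.inl (Function.extend_apply' _ _ _ hx)
  refine ⟨f, ⟨fun b x => ?_, fun b c g => ?_, fun u v hu hv => ?_⟩⟩
  · rcases hf' b x with hx | ⟨n, rfl⟩
    · rw [hx, one_pow]
    · rw [hf, h_sq]
  · by_cases hg : g = 1
    · subst hg
      refine Filter.Eventually.of_forall fun x => ?_
      rw [one_mul]
      rcases hf' b x with hx | ⟨n, rfl⟩
      · rw [hx]; exact Commute.one_left _
      rcases hf' c (e b n) with hx | ⟨m, hm⟩
      · rw [hx]; exact Commute.one_right _
      have hmn := hz.injective hm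
      obtain rfl : c = b := by
        cases b <;> cases c <;> simp only [Bool.toNat_true, Bool.toNat_false] at hmn <;>
          first | rfl | omega
      exact Commute.refl _
    · refine (hz.finite_overlap hg).subset fun x hx => ?_
      rcases hf' b x with h1 | ⟨n, hn⟩
      · exact (hx (show Commute _ _ by rw [h1]; exact Commute.one_left _)).elim
      rcases hf' c (g * x) with h2 | ⟨m, hm⟩
      · exact (hx (show Commute _ _ by rw [h2]; exact Commute.one_right _)).elim
      exact ⟨⟨_, hn⟩, ⟨_, hm⟩⟩
  · obtain ⟨m, rfl⟩ : u ∈ Set.range h := h_range ▸ hu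
    obtain ⟨n, rfl⟩ : v ∈ Set.range h := h_range ▸ hv
    refine ⟨e true m, e false n, hf _ _, hf _ _, fun u hu => ?_⟩
    by_contra! hne
    obtain ⟨m', hm⟩ := (hf' _ _).resolve_left hne.1
    obtain ⟨n', hn⟩ := (hf' _ _).resolve_left hne.2
    have h1 : u = (e true m)⁻¹ * e true m' := by rw [hm]; group
    have h2 : u = (e false n)⁻¹ * e false n' := by rw [hn]; group
    have h_eq := hz.eq_of_quotient_eq (a := 2 * m + 1) (c := 2 * m' + 1) (b := 2 * n + 0)
      (d := 2 * n' + 0) (by omega) (by omega) (by omega) (by omega) (h1.symm.trans h2)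
    refine hu ?_
    rw [h1, inv_mul_eq_one]
    exact congrArg z h_eq

/-- A subgroup containing the commutators of a generating set by whose elements it is normalized
is everything, if every element of the group is a commutator. -/
lemma Subgroup.eq_top_of_commutator_mem {H : Type*} [Group H] {S : Set H} {M : Subgroup H}
    (hS : Subgroup.closure S = ⊤) (h_perfect : ∀ g : H, ∃ a b : H, g = ⁅a, b⁆)
    (h_conj : ∀ s ∈ S, s ∈ Subgroup.normalizer (M : Set H))
    (h_comm : ∀ s ∈ S, ∀ t ∈ S, ⁅s, t⁆ ∈ M) :
    M = ⊤ := by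
  have hM : M.Normal := by
    rw [← Subgroup.normalizer_eq_top_iff, eq_top_iff, ← hS]
    exact (Subgroup.closure_le _).2 h_conj
  have h_mk : ∀ a b : H, Commute (QuotientGroup.mk' M a) (QuotientGroup.mk' M b) := by
    intro a b
    have h : ∀ x : H, x ∈ Subgroup.closure S := fun x => hS ▸ Subgroup.mem_top x
    refine Subgroup.closure_induction₂
      (p := fun x y _ _ => Commute (QuotientGroup.mk' M x) (QuotientGroup.mk' M y))
      ?_ ?_ ?_ ?_ ?_ ?_ ?_ (h a) (h b)
    · intro x y hx hy
      rw [← commutatorElement_eq_one_iff_commute, ← map_commutatorElement]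
      exact (QuotientGroup.eq_one_iff _).2 (h_comm x hx y hy)
    · intro x _; rw [map_one]; exact Commute.one_left _
    · intro x _; rw [map_one]; exact Commute.one_right _
    · intro x y w _ _ _ h1 h2; rw [map_mul]; exact h1.mul_left h2
    · intro x y w _ _ _ h1 h2; rw [map_mul]; exact h1.mul_right h2
    · intro x y _ _ h1; rw [map_inv]; exact h1.inv_left
    · intro x y _ _ h1; rw [map_inv]; exact h1.inv_right
  refine eq_top_iff.2 fun g _ => ?_
  obtain ⟨a, b, rfl⟩ := h_perfect g
  rw [← QuotientGroup.eq_one_iff, ← QuotientGroup.mk'_apply, map_commutatorElement]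
  exact commutatorElement_eq_one_iff_commute.2 (h_mk a b)

namespace RegularWreathProduct

variable {Q H : Type*} [Group Q] [Group H]

/-- The inclusion of the base group in the regular wreath product. -/
def base : (Q → H) →* H ≀ᵣ Q where
  toFun φ := ⟨φ, 1⟩
  map_one' := rfl
  map_mul' φ ψ := by ext <;> simp

@[simp] lemma base_left (φ : Q → H) : (base φ).left = φ := rfl

@[simp] lemma base_right (φ : Q → H) : (base φ).right = 1 := rfl

lemma base_injective : Function.Injective (base : (Q → H) →* H ≀ᵣ Q) :=
  fun _ _ h => congrArg left h

lemma eq_base {w : H ≀ᵣ Q} (hw : w.right = 1) : w = base w.left := by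
  ext
  · rfl
  · exact hw

lemma inl_mul_base_mul_inl (q : Q) (φ : Q → H) :
    (inl q)⁻¹ * base φ * inl q = base fun x => φ (q * x) := by
  ext <;> simp

/-- The subgroup of the regular wreath product of `H` and `Q` generated by `Q` and two functions
from `Q` to `H`. -/
def pairSubgroup (f : Bool → Q → H) : Subgroup (H ≀ᵣ Q) :=
  (inl : Q →* H ≀ᵣ Q).range ⊔ Subgroup.closure (Set.range fun b => base (f b))

lemma pairSubgroup_fg [Group.FG Q] (f : Bool → Q → H) : (pairSubgroup f).FG :=
  Subgroup.FG.sup ((Group.fg_iff_subgroup_fg _).1 inferInstance)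
    ((Subgroup.fg_iff _).2 ⟨_, rfl, Set.finite_range _⟩)

variable {f : Bool → Q → H}

lemma inl_mem_pairSubgroup (q : Q) : inl q ∈ pairSubgroup f :=
  le_sup_left (α := Subgroup (H ≀ᵣ Q)) ⟨q, rfl⟩

lemma translate_mem_pairSubgroup {φ : Q → H} (hφ : base φ ∈ pairSubgroup f) (q : Q) :
    base (fun x => φ (q * x)) ∈ pairSubgroup f := by
  rw [← inl_mul_base_mul_inl]
  exact mul_mem (mul_mem (inv_mem (inl_mem_pairSubgroup q)) hφ) (inl_mem_pairSubgroup q)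

lemma base_mem_pairSubgroup (b : Bool) : base (f b) ∈ pairSubgroup f :=
  le_sup_right (α := Subgroup (H ≀ᵣ Q)) (Subgroup.subset_closure ⟨b, rfl⟩)

lemma mulSingle_mem_pairSubgroup [DecidableEq Q] (hf : SparsePair f) (hH : SelfDistorted H)
    (x : Q) (h : H) : base (Pi.mulSingle x h) ∈ pairSubgroup f := by
  have h_one : ∀ h : H, base (Pi.mulSingle (1 : Q) h) ∈ pairSubgroup f := by
    suffices (pairSubgroup f).comap (base.comp (MonoidHom.mulSingle (fun _ : Q => H) 1)) = ⊤ from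
      fun h => this.ge (Subgroup.mem_top h)
    refine Subgroup.eq_top_of_commutator_mem (S := {x : H | x ^ 2 = 1}) ?_ ?_ ?_ ?_
    · refine eq_top_iff.2 fun g _ => ?_
      obtain ⟨_, _, _, _, hg⟩ := hH g
      exact hg.mem_closure_involutions
    · intro g
      obtain ⟨_, _, _, _, hg⟩ := hH g
      exact ⟨_, _, hg.eq_commutator⟩
    · intro s hs
      obtain ⟨y, _, hy, -, -⟩ := hf.meet s s hs hs
      have h_conj : ∀ m : H, base (Pi.mulSingle (1 : Q) m) ∈ pairSubgroup f →
          base (Pi.mulSingle (1 : Q) (s * m * s⁻¹)) ∈ pairSubgroup f := by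
        intro m hm
        have hφ := translate_mem_pairSubgroup (base_mem_pairSubgroup (f := f) true) y
        convert mul_mem (mul_mem hφ hm) (inv_mem hφ)
        rw [← map_mul, ← map_inv, ← map_mul]
        congr 1
        ext u
        by_cases hu : u = 1
        · subst hu; simp [hy]
        · simp [hu]
      have hss : s * s = 1 := by rw [← sq]; exact hs
      refine Subgroup.mem_normalizer_iff.2 fun m => ⟨h_conj m, fun hm => ?_⟩
      have := h_conj _ hm
      rwa [← mul_assoc, ← mul_assoc, hss, one_mul, mul_assoc, ← mul_inv_rev, hss, inv_one,
        mul_one] at this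
    · intro s hs t ht
      obtain ⟨y, w, hy, hw, h_meet⟩ := hf.meet s t hs ht
      have hφ := translate_mem_pairSubgroup (base_mem_pairSubgroup (f := f) true) y
      have hψ := translate_mem_pairSubgroup (base_mem_pairSubgroup (f := f) false) w
      have h_comm := mul_mem (mul_mem (mul_mem hφ hψ) (inv_mem hφ)) (inv_mem hψ)
      rw [← commutatorElement_def, ← map_commutatorElement] at h_comm
      rw [Subgroup.mem_comap]
      convert h_comm
      rw [MonoidHom.comp_apply]
      congr 1
      ext u
      by_cases hu : u = 1
      · subst hu; simp [hy, hw, commutatorElement_def]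
      · rcases h_meet u hu with h | h <;> simp [hu, h, commutatorElement_def]
  have := translate_mem_pairSubgroup (h_one h) x⁻¹
  convert this using 2
  ext u
  simp [Pi.mulSingle_apply, inv_mul_eq_one, eq_comm]

lemma exists_sublinear_of_finite (hf : SparsePair f) (hH : SelfDistorted H)
    {ℓ : pairSubgroup f → ℝ} (hℓ : IsLength ℓ) {φ : Q → H}
    (hφ : ∀ᶠ x in Filter.cofinite, φ x = 1) :
    ∃ w : pairSubgroup f, (w : H ≀ᵣ Q) = base φ ∧ IsSublinear ℓ w := by
  classical
  suffices ∀ (s : Finset Q) (φ : Q → H), (∀ x ∉ s, φ x = 1) →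
      ∃ w : pairSubgroup f, (w : H ≀ᵣ Q) = base φ ∧ IsSublinear ℓ w from
    have hφ' : {x | φ x ≠ 1}.Finite := Filter.eventually_cofinite.1 hφ
    this hφ'.toFinset φ fun x hx => by simpa using hx
  intro s
  induction s using Finset.induction_on with
  | empty =>
    intro φ hφ
    refine ⟨1, ?_, IsSublinear.one ℓ⟩
    rw [show φ = 1 from funext fun x => hφ x (Finset.notMem_empty x), map_one]
    rfl
  | insert a s _ ih =>
    intro φ hφ
    obtain ⟨w, hw, hw'⟩ := ih (Function.update φ a 1) fun x hx => by
      by_cases hxa : x = a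
      · subst hxa; simp
      · rw [Function.update_of_ne hxa]
        exact hφ x (by simp [hxa, hx])
    let δ : H →* pairSubgroup f :=
      (base.comp (MonoidHom.mulSingle (fun _ : Q => H) a)).codRestrict _
        (mulSingle_mem_pairSubgroup hf hH a)
    have hδ : ((δ (φ a) : pairSubgroup f) : H ≀ᵣ Q) = base (Pi.mulSingle a (φ a)) := rfl
    obtain ⟨_, _, _, _, h_wit⟩ := hH (φ a)
    have h_comm : Commute (δ (φ a)) w := by
      refine Subtype.ext ?_
      rw [Subgroup.coe_mul, Subgroup.coe_mul, hδ, hw, ← map_mul, ← map_mul]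
      congr 1
      ext x
      by_cases hx : x = a
      · subst hx; simp
      · simp [hx]
    refine ⟨δ (φ a) * w, ?_, ((h_wit.map δ).isSublinear hℓ).mul_of_commute hℓ hw' h_comm⟩
    rw [Subgroup.coe_mul, hδ, hw, ← map_mul]
    congr 1
    ext x
    by_cases hx : x = a
    · subst hx; simp
    · simp [hx]

/-- The group of functions generated by the translates of two functions. -/
def translateSubgroup (f : Bool → Q → H) : Subgroup (Q → H) :=
  Subgroup.closure (Set.range fun p : Bool × Q => fun x => f p.1 (p.2 * x))

lemma translate_mem_translateSubgroup {φ : Q → H} (hφ : φ ∈ translateSubgroup f) (q : Q) :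
    (fun x => φ (q * x)) ∈ translateSubgroup f := by
  let τ : (Q → H) →* (Q → H) :=
    { toFun := fun φ x => φ (q * x)
      map_one' := rfl
      map_mul' := fun _ _ => rfl }
  suffices translateSubgroup f ≤ (translateSubgroup f).comap τ from this hφ
  refine (Subgroup.closure_le _).2 ?_
  rintro _ ⟨⟨b, g⟩, rfl⟩
  exact Subgroup.subset_closure ⟨(b, g * q), funext fun x => by simp [τ, mul_assoc]⟩

lemma left_mem_translateSubgroup {w : H ≀ᵣ Q} (hw : w ∈ pairSubgroup f) :
    w.left ∈ translateSubgroup f := by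
  let K : Subgroup (H ≀ᵣ Q) :=
    { carrier := {w | w.left ∈ translateSubgroup f}
      one_mem' := one_mem (translateSubgroup f)
      mul_mem' := fun {v w} hv hw => by
        rw [Set.mem_ofPred_eq, mul_left]
        exact mul_mem hv (translate_mem_translateSubgroup hw _)
      inv_mem' := fun {w} hw => by
        rw [Set.mem_ofPred_eq, inv_left]
        exact translate_mem_translateSubgroup (inv_mem hw) w.right }
  suffices pairSubgroup f ≤ K from this hw
  refine sup_le ?_ ((Subgroup.closure_le _).2 ?_)
  · rintro _ ⟨q, rfl⟩
    exact one_mem (translateSubgroup f)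
  · rintro _ ⟨b, rfl⟩
    exact Subgroup.subset_closure ⟨(b, 1), by simp⟩

lemma eventually_commute (hf : SparsePair f) {φ ψ : Q → H} (hφ : φ ∈ translateSubgroup f)
    (hψ : ψ ∈ translateSubgroup f) : ∀ᶠ x in Filter.cofinite, Commute (φ x) (ψ x) := by
  refine Subgroup.closure_induction₂
    (p := fun φ ψ _ _ => ∀ᶠ x in Filter.cofinite, Commute (φ x) (ψ x))
    ?_ ?_ ?_ ?_ ?_ ?_ ?_ hφ hψ
  · rintro _ _ ⟨⟨b, g⟩, rfl⟩ ⟨⟨c, k⟩, rfl⟩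
    have := (mul_right_injective g).tendsto_cofinite.eventually (hf.commute b c (k * g⁻¹))
    simpa [mul_assoc] using this
  · exact fun φ _ => Filter.Eventually.of_forall fun x => Commute.one_left _
  · exact fun φ _ => Filter.Eventually.of_forall fun x => Commute.one_right _
  · intro _ _ _ _ _ _ h1 h2
    filter_upwards [h1, h2] with x h1 h2 using h1.mul_left h2
  · intro _ _ _ _ _ _ h1 h2
    filter_upwards [h1, h2] with x h1 h2 using h1.mul_right h2
  · intro _ _ _ _ h1
    filter_upwards [h1] with x h1 using h1.inv_left
  · intro _ _ _ _ h1
    filter_upwards [h1] with x h1 using h1.inv_right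

lemma eventually_sq_eq_one (hf : SparsePair f) {φ : Q → H} (hφ : φ ∈ translateSubgroup f) :
    ∀ᶠ x in Filter.cofinite, φ x ^ 2 = 1 := by
  refine Subgroup.closure_induction (p := fun φ _ => ∀ᶠ x in Filter.cofinite, φ x ^ 2 = 1)
    ?_ ?_ ?_ ?_ hφ
  · rintro _ ⟨⟨b, g⟩, rfl⟩
    exact Filter.Eventually.of_forall fun x => hf.sq b _
  · exact Filter.Eventually.of_forall fun x => one_pow 2
  · intro φ ψ hφ hψ h1 h2
    filter_upwards [h1, h2, eventually_commute hf hφ hψ] with x h1 h2 h3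
    rw [Pi.mul_apply, h3.mul_pow, h1, h2, one_mul]
  · intro φ _ h1
    filter_upwards [h1] with x h1
    rw [Pi.inv_apply, inv_pow, h1, inv_one]

theorem isSublinear_pairSubgroup (hf : SparsePair f) (hH : SelfDistorted H)
    (hQ : ∀ q : Q, IsOfFinOrder q) {ℓ : pairSubgroup f → ℝ} (hℓ : IsLength ℓ)
    (w : pairSubgroup f) : IsSublinear ℓ w := by
  obtain ⟨m, hm, hw⟩ := (hQ (w : H ≀ᵣ Q).right).exists_pow_eq_one
  set v : pairSubgroup f := w ^ m
  have hv : (v : H ≀ᵣ Q).right = 1 := by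
    rw [SubgroupClass.coe_pow, ← rightHom_eq_right, map_pow, rightHom_eq_right, hw]
  obtain ⟨u, hu, hu'⟩ := exists_sublinear_of_finite hf hH hℓ
    (φ := (v : H ≀ᵣ Q).left ^ 2) (eventually_sq_eq_one hf (left_mem_translateSubgroup v.2))
  have huv : u = v ^ 2 := Subtype.ext (by
    rw [hu, map_pow, ← eq_base hv]; rfl)
  exact ((huv ▸ hu').of_pow hℓ two_pos).of_pow hℓ hm

end RegularWreathProduct

namespace IsIsomAction

variable {C X : Type*} [Group C] [MetricSpace X] {act : C → X → X}

lemma isLength (h : IsIsomAction C X act) (x : X) : IsLength fun g => dist x (act g x) where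
  nonneg _ := dist_nonneg
  mul_le g k := by
    refine (dist_triangle x (act g x) (act (g * k) x)).trans_eq ?_
    rw [h.act_mul, h.isometry]
  inv g := by
    rw [← h.isometry g, ← h.act_mul, mul_inv_cancel, h.act_one, dist_comm]

lemma not_loxodromicWith (h : IsIsomAction C X act) {g : C}
    (hg : ∀ ℓ : C → ℝ, IsLength ℓ → IsSublinear ℓ g) :
    ¬ LoxodromicWith (fun a b : X => dist a b) act g := by
  rintro ⟨x, A, B, hA, -, hqi⟩
  have hA' : 0 < A := one_pos.trans_le hA
  obtain ⟨B', hB'⟩ := hg _ (h.isLength x) (1 / (2 * A)) (by positivity)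
  obtain ⟨n, hn⟩ := exists_nat_gt (2 * A * (B + B'))
  have h1 := (hqi 0 n).1
  have h2 := hB' n
  simp only [zdist, zpow_zero, h.act_one, zpow_natCast, Int.cast_zero, zero_sub, abs_neg,
    Int.cast_natCast, Nat.abs_cast] at h1
  have h3 : (n : ℝ) / A - 1 / (2 * A) * n = n / (2 * A) := by field_simp; ring
  have h4 : B + B' < n / (2 * A) := by rw [lt_div_iff₀ (by positivity)]; linarith
  linarith

end IsIsomAction

end

/-- every countable group embeds into a finitely generated group with
property (NL). -/
theorem stmt_12 (G : Type uG) [Group G] [Countable G] :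
    ∃ E : EmbeddingIntoGroup G, Group.FG E.target ∧ PropNL.{uX, uG} E.target := by
  obtain ⟨H, _, _, φ, hφ, hH⟩ := exists_countable_selfDistorted G
  obtain ⟨f, hf⟩ := exists_sparsePair guptaSidki H
  classical
  let δ : H →* RegularWreathProduct.pairSubgroup f :=
    (RegularWreathProduct.base.comp (MonoidHom.mulSingle (fun _ : guptaSidki => H) 1)).codRestrict _
      (RegularWreathProduct.mulSingle_mem_pairSubgroup hf hH 1)
  have hδ : Function.Injective δ := fun a b hab =>
    Pi.mulSingle_injective (M := fun _ : guptaSidki => H) 1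
      (RegularWreathProduct.base_injective (congrArg Subtype.val hab))
  refine ⟨⟨RegularWreathProduct.pairSubgroup f, δ.comp φ, hδ.comp hφ⟩, ?_, fun A g => ?_⟩
  · exact (Group.fg_iff_subgroup_fg _).2 (RegularWreathProduct.pairSubgroup_fg f)
  · exact A.isIsomAction.not_loxodromicWith fun ℓ hℓ =>
      RegularWreathProduct.isSublinear_pairSubgroup hf hH GuptaSidki.isOfFinOrder hℓ g
end
end

section
/- Every countable group G containing an element of infinite order can be embedded into a finitely generated simple group with property (NL). -/
noncomputable section

open Metric

universe uX uG

/-! ### From thin triangles to the four-point condition -/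

section FourPoint

variable {X : Type*} [MetricSpace X]

lemma IsGeodesicSeg.dist_add_dist {x y p : X} {f : ℝ → X} (hf : IsGeodesicSeg x y f)
    (hp : p ∈ geodSet x y f) : dist x p + dist p y = dist x y := by
  obtain ⟨t, ht, rfl⟩ := hp
  obtain ⟨h0, h1, h⟩ := hf
  have e1 := h 0 ⟨le_rfl, dist_nonneg⟩ t ht
  have e2 := h t ht _ ⟨dist_nonneg, le_rfl⟩
  rw [h0, zero_sub, abs_neg, abs_of_nonneg ht.1] at e1
  rw [h1, abs_of_nonpos (by linarith [ht.2])] at e2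
  linarith

lemma IsGeodesicSeg.left_mem {x y : X} {f : ℝ → X} (hf : IsGeodesicSeg x y f) :
    x ∈ geodSet x y f :=
  ⟨0, ⟨le_rfl, dist_nonneg⟩, hf.1⟩

lemma IsGeodesicSeg.gromovProd_le_dist {x y p : X} {f : ℝ → X} (hf : IsGeodesicSeg x y f)
    (hp : p ∈ geodSet x y f) (w : X) : gromovProd dist w x y ≤ dist w p := by
  have h := hf.dist_add_dist hp
  have h1 := dist_triangle w p x
  have h2 := dist_triangle w p y
  rw [dist_comm p x] at h1
  unfold gromovProd
  linarith

/-- In a triangle with thin sides, some point of a side is at distance from the opposite vertex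
at most the Gromov product, up to an additive constant. -/
lemma RipsHyperbolic.exists_dist_le {δ : ℝ} (hδ : 0 ≤ δ) (hX : RipsHyperbolic X δ)
    {x y w : X} {fxy fyw fxw : ℝ → X} (hxy : IsGeodesicSeg x y fxy)
    (hyw : IsGeodesicSeg y w fyw) (hxw : IsGeodesicSeg x w fxw) :
    ∃ p ∈ geodSet x y fxy, dist w p ≤ gromovProd dist w x y + 2 * δ + 2 := by
  set S : Set ℝ := {t | t ∈ Set.Icc 0 (dist x y) ∧ WithinDistOf δ (fxy t) (geodSet x w fxw)}
  have h0 : (0 : ℝ) ∈ S :=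
    ⟨⟨le_rfl, dist_nonneg⟩, x, hxw.left_mem, by rw [hxy.1, dist_self]; exact hδ⟩
  have hbdd : BddAbove S := ⟨dist x y, fun t ht => ht.1.2⟩
  obtain ⟨t, ⟨htI, q, hq, hpq⟩, hst⟩ :=
    exists_lt_of_lt_csSup ⟨0, h0⟩ (sub_one_lt (sSup S))
  set t' := min (t + 2) (dist x y)
  have ht'I : t' ∈ Set.Icc 0 (dist x y) :=
    ⟨le_min (by linarith [htI.1]) dist_nonneg, min_le_right _ _⟩
  have hclose : WithinDistOf δ (fxy t') (geodSet y w fyw) := by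
    rcases le_total (t + 2) (dist x y) with h | h
    · obtain ⟨r, hr | hr, hd⟩ := (hX x y w fxy fyw fxw hxy hyw hxw).1 (fxy t') ⟨t', ht'I, rfl⟩
      · exact ⟨r, hr, hd⟩
      · have hmem : t' ∈ S := ⟨ht'I, r, hr, hd⟩
        have h1 := le_csSup hbdd hmem
        have h2 : t' = t + 2 := min_eq_left h
        linarith
    · have h2 : t' = dist x y := min_eq_right h
      exact ⟨y, hyw.left_mem, by rw [h2, hxy.2.1, dist_self]; exact hδ⟩
  obtain ⟨q', hq', hpq'⟩ := hclose
  have htt' : dist (fxy t) (fxy t') ≤ 2 := by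
    rw [hxy.2.2 t htI t' ht'I, abs_le]
    have h1 : t' ≤ t + 2 := min_le_left _ _
    have h2 : t ≤ t' := le_min (by linarith) htI.2
    constructor <;> linarith
  refine ⟨fxy t, ⟨t, htI, rfl⟩, ?_⟩
  have hp : fxy t ∈ geodSet x y fxy := ⟨t, htI, rfl⟩
  have e0 := hxy.dist_add_dist hp
  have e1 := hxw.dist_add_dist hq
  have e2 := hyw.dist_add_dist hq'
  have a1 := dist_triangle x q (fxy t)
  have a2 := dist_triangle (fxy t) q w
  have a3 := dist_triangle4 y q' (fxy t') (fxy t)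
  have a4 := dist_triangle4 (fxy t) (fxy t') q' w
  rw [dist_comm q] at a1
  rw [dist_comm q' (fxy t'), dist_comm (fxy t') (fxy t), dist_comm y (fxy t)] at a3
  rw [dist_comm (fxy t) w] at a2 a4
  unfold gromovProd
  rw [dist_comm w x, dist_comm w y]
  linarith

lemma RipsHyperbolic.fourPointHyperbolic {δ : ℝ} (hδ : 0 ≤ δ) (hX : RipsHyperbolic X δ)
    (hg : GeodesicSpace X) : FourPointHyperbolic (dist : X → X → ℝ) := by
  refine ⟨3 * δ + 2, by linarith, fun w x y z => ?_⟩
  obtain ⟨fxy, hxy⟩ := hg x y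
  obtain ⟨fyw, hyw⟩ := hg y w
  obtain ⟨fxw, hxw⟩ := hg x w
  obtain ⟨fyz, hyz⟩ := hg y z
  obtain ⟨fxz, hxz⟩ := hg x z
  obtain ⟨p, hp, hwp⟩ := hX.exists_dist_le hδ hxy hyw hxw
  have hsymm : gromovProd dist w z y = gromovProd dist w y z := by
    unfold gromovProd
    rw [dist_comm z y]
    ring
  obtain ⟨q, hq | hq, hpq⟩ := (hX x y z fxy fyz fxz hxy hyz hxz).1 p hp
  · have h1 := hyz.gromovProd_le_dist hq w
    have h2 := dist_triangle w p q
    have h3 := min_le_right (gromovProd dist w x z) (gromovProd dist w z y)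
    linarith
  · have h1 := hxz.gromovProd_le_dist hq w
    have h2 := dist_triangle w p q
    have h3 := min_le_left (gromovProd dist w x z) (gromovProd dist w z y)
    linarith

end FourPoint

/-! ### Hyperbolic length functions on groups -/

/-- A length function on a group whose associated left-invariant pseudometric satisfies the
four-point hyperbolicity condition. -/
structure HypLength (Γ : Type*) [Group Γ] where
  len : Γ → ℝ
  len_one : len 1 = 0
  len_inv : ∀ a, len a⁻¹ = len a
  len_mul : ∀ a b, len (a * b) ≤ len a + len b
  δ : ℝ
  δ_nonneg : 0 ≤ δ
  hyp : ∀ a b c,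
    min ((len a + len c - len (a⁻¹ * c)) / 2) ((len c + len b - len (c⁻¹ * b)) / 2) - δ ≤
      (len a + len b - len (a⁻¹ * b)) / 2

namespace HypLength

variable {Γ : Type*} [Group Γ] (L : HypLength Γ)

/-- The Gromov product based at the identity. -/
def gp (a b : Γ) : ℝ := (L.len a + L.len b - L.len (a⁻¹ * b)) / 2

lemma len_nonneg (a : Γ) : 0 ≤ L.len a := by
  have h := L.len_mul a a⁻¹
  rw [mul_inv_cancel, L.len_one, L.len_inv] at h
  linarith

lemma gp_comm (a b : Γ) : L.gp a b = L.gp b a := by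
  unfold gp
  rw [← L.len_inv (a⁻¹ * b), mul_inv_rev, inv_inv]
  ring

lemma min_gp_le (a b c : Γ) : min (L.gp a c) (L.gp c b) ≤ L.gp a b + L.δ := by
  have := L.hyp a b c
  unfold gp
  linarith

/-- The four-point condition for a chain of four elements. -/
lemma gp_chain (a b c d : Γ) {r : ℝ} (h1 : r ≤ L.gp a b) (h2 : r ≤ L.gp b c)
    (h3 : r ≤ L.gp c d) : r ≤ L.gp a d + 2 * L.δ := by
  have e1 := (le_min h1 h2).trans (L.min_gp_le a c b)
  have e2 := (le_min (sub_le_iff_le_add.2 e1)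
    (by linarith [L.δ_nonneg] : r - L.δ ≤ L.gp c d)).trans (L.min_gp_le a d c)
  linarith

lemma gp_nonneg (a b : Γ) : 0 ≤ L.gp a b := by
  have h := L.len_mul a⁻¹ b
  rw [L.len_inv] at h
  unfold gp
  linarith

lemma len_mul_eq (a b : Γ) : L.len (a * b) = L.len a + L.len b - 2 * L.gp a⁻¹ b := by
  unfold gp
  rw [inv_inv, L.len_inv]
  ring

lemma len_le_len_mul_add (a b : Γ) : L.len a ≤ L.len (a * b) + L.len b := by
  have h := L.len_mul (a * b) b⁻¹
  rwa [mul_inv_cancel_right, L.len_inv] at h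

lemma gp_le_gp_mul_right (a b h : Γ) : L.gp a b ≤ L.gp a (b * h) + L.len h := by
  have h1 := L.len_le_len_mul_add b h
  have h2 := L.len_mul (a⁻¹ * b) h
  unfold gp
  rw [← mul_assoc]
  linarith

lemma len_sub_le_gp_mul_right (b h : Γ) : L.len b - L.len h ≤ L.gp b (b * h) := by
  have h1 := L.len_le_len_mul_add b h
  unfold gp
  rw [inv_mul_cancel_left]
  linarith

/-- If `a`, `b` and `a * b` do not double their length when squared, the points `a⁻¹` and `b`
lie in the same direction. -/
lemma min_len_le_gp {a b : Γ} {C : ℝ} (hC : 0 ≤ C) (ha : L.len (a * a) ≤ L.len a + C)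
    (hb : L.len (b * b) ≤ L.len b + C)
    (hab : L.len (a * b * (a * b)) ≤ L.len (a * b) + C) :
    min (L.len a) (L.len b) / 2 - (2 * L.δ + C / 2) ≤ L.gp a⁻¹ b := by
  by_contra! hlt
  have hδ := L.δ_nonneg
  set m := min (L.len a) (L.len b) with hm
  have hma : m ≤ L.len a := min_le_left _ _
  have hmb : m ≤ L.len b := min_le_right _ _
  have ea := L.len_mul_eq a a
  have eb := L.len_mul_eq b b
  have eab := L.len_mul_eq (a * b) (a * b)
  have ep := L.len_mul_eq a b
  have hq : L.gp a b⁻¹ ≤ L.gp a⁻¹ b + 2 * L.δ := by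
    by_contra! hq
    have hr : min (m / 2 - C / 2) (L.gp a b⁻¹) ≤ L.gp a⁻¹ b + 2 * L.δ := by
      refine L.gp_chain a⁻¹ a b⁻¹ b ?_ (min_le_right _ _) ?_
      · exact (min_le_left _ _).trans (by linarith)
      · exact (min_le_left _ _).trans (by linarith)
    rcases min_le_iff.1 hr with h | h <;> linarith
  have e1 : L.gp a (a * b) = L.len a - L.gp a⁻¹ b := by
    unfold gp at ep ⊢
    rw [inv_mul_cancel_left]
    linarith
  have e2 : L.gp (a * b)⁻¹ b⁻¹ = L.len b - L.gp a⁻¹ b := by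
    unfold gp at ep ⊢
    rw [inv_inv, mul_inv_cancel_right, L.len_inv, L.len_inv b]
    linarith
  have hr : min (m - L.gp a⁻¹ b) (L.gp (a * b) (a * b)⁻¹) ≤ L.gp a b⁻¹ + 2 * L.δ := by
    refine L.gp_chain a (a * b) (a * b)⁻¹ b⁻¹ ?_ (min_le_right _ _) ?_
    · exact (min_le_left _ _).trans (by linarith)
    · exact (min_le_left _ _).trans (by linarith)
  rw [L.gp_comm (a * b)] at hr
  rcases min_le_iff.1 hr with h | h <;> linarith

/-- If a group is a bounded product of subgroups no element of which doubles its length when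
squared, and there are enough commuting relations and unbounded subgroups around, then no element
of the group essentially doubles its length when squared. -/
theorem exists_len_mul_self_le {ι : Type*} (F K : ι → Subgroup Γ) {C : ℝ} (hC : 0 ≤ C)
    (hF : ∀ w, ∀ a ∈ F w, L.len (a * a) ≤ L.len a + C)
    (hsep : ∀ w₁ w₂, ∃ z u₁ u₂, F w₁ ≤ F u₁ ∧ K z ≤ F u₁ ∧ F w₂ ≤ F u₂ ∧ K z ≤ F u₂)
    (hconj : ∀ w g, ∃ w', ∀ c ∈ F w, g * c * g⁻¹ ∈ F w')
    (hunb : ∀ z R, ∃ c ∈ K z, R ≤ L.len c)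
    (hgen : ∀ g, ∃ w₁ w₂ w₃, ∃ s₁ ∈ F w₁, ∃ s₂ ∈ F w₂, ∃ s₃ ∈ F w₃, g = s₁ * s₂ * s₃) :
    ∃ C', ∀ g, L.len (g * g) ≤ L.len g + C' := by
  have hδ := L.δ_nonneg
  set E := 2 * L.δ + C / 2 with hE
  have key : ∀ u, ∀ a ∈ F u, ∀ b ∈ F u, min (L.len a) (L.len b) / 2 - E ≤ L.gp a b := by
    intro u a ha b hb
    have h := L.min_len_le_gp hC (hF u _ (inv_mem ha)) (hF u _ hb)
      (hF u _ (mul_mem (inv_mem ha) hb))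
    rwa [inv_inv, L.len_inv] at h
  have step : ∀ w, ∀ s ∈ F w, ∀ g t, ∃ N, ∀ c ∈ F t, N ≤ L.len c →
      L.len (s * (g * c)) ≤ L.len (g * c) + (2 * E + 2 * L.δ) := by
    intro w s hs g t
    obtain ⟨w', hw'⟩ := hconj t g
    obtain ⟨z, u₁, u₂, h1, h2, h3, h4⟩ := hsep w w'
    obtain ⟨c', hc', hlen⟩ := hunb z (L.len s + 2 * L.len g)
    refine ⟨L.len s + 4 * L.len g, fun c hc hcl => ?_⟩
    have hg := L.len_nonneg g
    have k1 := key u₁ _ (inv_mem (h1 hs)) c' (h2 hc')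
    have k2 := key u₂ c' (h4 hc') _ (h3 (hw' c hc))
    have k3 := L.gp_le_gp_mul_right c' (g * c * g⁻¹) g
    rw [inv_mul_cancel_right] at k3
    rw [L.len_inv, min_eq_left (by linarith)] at k1
    have k4 : L.len s + 2 * L.len g ≤ L.len (g * c * g⁻¹) := by
      have m1 := L.len_mul g⁻¹ (g * c)
      have m2 := L.len_le_len_mul_add (g * c) g⁻¹
      rw [inv_mul_cancel_left, L.len_inv] at m1
      rw [L.len_inv] at m2
      linarith
    have k5 : L.len s + 2 * L.len g ≤ min (L.len c') (L.len (g * c * g⁻¹)) := le_min hlen k4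
    have k6 := (le_min k1 (by linarith : L.len s / 2 - E ≤ L.gp c' (g * c))).trans
      (L.min_gp_le _ _ _)
    rw [L.len_mul_eq]
    linarith
  have triple : ∀ g t, ∃ N, ∀ c ∈ F t, N ≤ L.len c →
      L.len (g * c) ≤ L.len c + 3 * (2 * E + 2 * L.δ) := by
    intro g t
    obtain ⟨w₁, w₂, w₃, s₁, h₁, s₂, h₂, s₃, h₃, rfl⟩ := hgen g
    obtain ⟨N₁, H₁⟩ := step w₁ s₁ h₁ (s₂ * s₃) t
    obtain ⟨N₂, H₂⟩ := step w₂ s₂ h₂ s₃ t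
    obtain ⟨N₃, H₃⟩ := step w₃ s₃ h₃ 1 t
    refine ⟨max N₁ (max N₂ N₃), fun c hc hcl => ?_⟩
    simp only [max_le_iff] at hcl
    have e1 := H₁ c hc hcl.1
    have e2 := H₂ c hc hcl.2.1
    have e3 := H₃ c hc hcl.2.2
    rw [one_mul] at e3
    simp only [mul_assoc] at e1 e2 ⊢
    linarith
  refine ⟨6 * (E + L.δ) + 2 * L.δ, fun g => ?_⟩
  obtain ⟨w, -⟩ := hgen g
  obtain ⟨z, t, -, -, ht, -⟩ := hsep w w
  obtain ⟨N₁, H₁⟩ := triple g t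
  obtain ⟨N₂, H₂⟩ := triple g⁻¹ t
  obtain ⟨c, hc, hcl⟩ := hunb z (max N₁ N₂)
  simp only [max_le_iff] at hcl
  have e1 := H₁ c (ht hc) hcl.1
  have e2 := H₂ c (ht hc) hcl.2
  rw [L.len_mul_eq] at e1 e2
  rw [inv_inv, L.len_inv] at e2
  rw [L.gp_comm g] at e2
  have e3 := (le_min (by linarith : L.len g / 2 - 3 * (E + L.δ) ≤ L.gp g⁻¹ c)
    (by linarith : L.len g / 2 - 3 * (E + L.δ) ≤ L.gp c g)).trans (L.min_gp_le _ _ _)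
  rw [L.len_mul_eq]
  linarith

lemma len_pow_le (a : Γ) (n : ℕ) : L.len (a ^ n) ≤ n * L.len a := by
  induction n with
  | zero => simp [L.len_one]
  | succ n ih =>
    have := L.len_mul (a ^ n) a
    rw [pow_succ]
    push_cast
    linarith

section Axis

variable {L} {a : Γ}

lemma gp_inv_pow_le (ha : L.len a + (3 * L.δ + 1) ≤ L.len (a * a))
    (n : ℕ) : L.gp a⁻¹ (a ^ n) ≤ L.gp a⁻¹ a + L.δ := by
  have hδ := L.δ_nonneg
  induction n with
  | zero =>
    have : L.gp a⁻¹ (a ^ 0) = 0 := by simp [gp, L.len_one, L.len_inv]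
    rw [this]
    linarith [L.gp_nonneg a⁻¹ a]
  | succ n ih =>
    have e1 : L.gp (a ^ (n + 1)) a = (L.len (a ^ (n + 1)) + L.len a - L.len (a ^ n)) / 2 := by
      rw [gp, ← L.len_inv (a ^ n)]
      congr 3
      group
    have e2 := L.len_mul_eq a (a ^ n)
    have e3 := L.len_mul_eq a a
    rw [← pow_succ'] at e2
    rcases min_le_iff.1 (L.min_gp_le a⁻¹ a (a ^ (n + 1))) with h | h
    · exact h
    · linarith

lemma len_pow_succ_ge (ha : L.len a + (3 * L.δ + 1) ≤ L.len (a * a))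
    (n : ℕ) : L.len (a ^ n) + 1 ≤ L.len (a ^ (n + 1)) := by
  have e2 := L.len_mul_eq a (a ^ n)
  have e3 := L.len_mul_eq a a
  rw [← pow_succ'] at e2
  have := gp_inv_pow_le ha n
  linarith [L.δ_nonneg]

lemma abs_le_len_zpow (ha : L.len a + (3 * L.δ + 1) ≤ L.len (a * a))
    (k : ℤ) : |(k : ℝ)| ≤ L.len (a ^ k) := by
  have hnat : ∀ n : ℕ, (n : ℝ) ≤ L.len (a ^ n) := by
    intro n
    induction n with
    | zero => simp [L.len_one]
    | succ n ih =>
      have := len_pow_succ_ge ha n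
      push_cast
      linarith
  obtain ⟨n, rfl | rfl⟩ := k.eq_nat_or_neg
  · simpa using hnat n
  · simpa [L.len_inv] using hnat n

lemma gp_inv_pow_pow_le (ha : L.len a + (3 * L.δ + 1) ≤ L.len (a * a))
    (m n : ℕ) :
    L.gp (a ^ m)⁻¹ (a ^ n) ≤ L.gp a⁻¹ a + 2 * L.δ := by
  have hδ := L.δ_nonneg
  cases m with
  | zero =>
    have : L.gp (a ^ 0)⁻¹ (a ^ n) = 0 := by simp [gp, L.len_one]
    rw [this]
    linarith [L.gp_nonneg a⁻¹ a]
  | succ m =>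
    have e1 : L.gp a⁻¹ (a ^ (m + 1))⁻¹ =
        (L.len (a ^ (m + 1)) + L.len a - L.len (a ^ m)) / 2 := by
      have : a⁻¹⁻¹ * (a ^ (m + 1))⁻¹ = (a ^ m)⁻¹ := by group
      rw [gp, this]
      simp only [L.len_inv]
      ring
    have e2 := L.len_mul_eq a (a ^ m)
    have e3 := L.len_mul_eq a a
    rw [← pow_succ'] at e2
    have h1 := gp_inv_pow_le ha m
    have h2 := gp_inv_pow_le ha n
    rcases min_le_iff.1 (L.min_gp_le a⁻¹ (a ^ n) (a ^ (m + 1))⁻¹) with h | h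
    · linarith
    · linarith

/-- Elements commuting with `a` stay close to the axis of `a`. -/
lemma exists_len_inv_mul_zpow_le (ha : L.len a + (3 * L.δ + 1) ≤ L.len (a * a))
    {h : Γ} (hc : Commute a h) :
    ∃ k : ℤ, L.len (h⁻¹ * a ^ k) ≤ 3 * L.gp a⁻¹ a + 10 * L.δ + L.len a := by
  have hδ := L.δ_nonneg
  set P := L.gp a⁻¹ a + 2 * L.δ with hP
  have hP0 : 0 ≤ P := by linarith [L.gp_nonneg a⁻¹ a]
  obtain ⟨n, hn⟩ := exists_nat_gt (P + 2 * L.δ + L.len h)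
  have hlen : ∀ k : ℤ, |(k : ℝ)| ≤ L.len (a ^ k) := abs_le_len_zpow ha
  have hnn : (n : ℝ) ≤ L.len (a ^ n) := by simpa using hlen n
  have hgp : L.gp (h⁻¹ * (a ^ n)⁻¹) (h⁻¹ * a ^ n) ≤ P + 2 * L.δ := by
    by_contra! hlt
    have c1 : h⁻¹ * (a ^ n)⁻¹ = (a ^ n)⁻¹ * h⁻¹ :=
      ((hc.pow_left n).inv_inv.eq).symm
    have c2 : h⁻¹ * a ^ n = a ^ n * h⁻¹ := ((hc.pow_left n).inv_right.eq).symm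
    have m1 := L.len_sub_le_gp_mul_right (a ^ n)⁻¹ h⁻¹
    have m2 := L.len_sub_le_gp_mul_right (a ^ n) h⁻¹
    simp only [L.len_inv] at m1 m2
    rw [L.gp_comm, ← c2] at m2
    rw [← c1] at m1
    have m3 := L.gp_chain (a ^ n)⁻¹ (h⁻¹ * (a ^ n)⁻¹) (h⁻¹ * a ^ n) (a ^ n)
      (r := min (L.len (a ^ n) - L.len h) (L.gp (h⁻¹ * (a ^ n)⁻¹) (h⁻¹ * a ^ n)))
      ((min_le_left _ _).trans m1) (min_le_right _ _) ((min_le_left _ _).trans m2)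
    have m4 := gp_inv_pow_pow_le ha n n
    rcases min_le_iff.1 (m3.trans (add_le_add_left m4 _)) with h' | h' <;> linarith
  set φ : ℕ → ℝ := fun j => L.gp (a ^ j)⁻¹ ((a ^ j)⁻¹ * a ^ n * h)
  set ψ : ℕ → ℝ := fun j => L.gp ((a ^ j)⁻¹ * a ^ n * h) ((a ^ j)⁻¹ * a ^ (2 * n))
  have hmin : ∀ j ≤ 2 * n, min (φ j) (ψ j) ≤ P + L.δ := by
    intro j hj
    have m1 := L.min_gp_le (a ^ j)⁻¹ ((a ^ j)⁻¹ * a ^ (2 * n)) ((a ^ j)⁻¹ * a ^ n * h)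
    have m2 := gp_inv_pow_pow_le ha j (2 * n - j)
    have m3 : (a ^ j)⁻¹ * a ^ (2 * n) = a ^ (2 * n - j) := by
      rw [inv_mul_eq_iff_eq_mul, ← pow_add, Nat.add_sub_cancel' hj]
    rw [← m3] at m2
    linarith
  have hψ : ∀ j, ψ j ≤ ψ (j + 1) + L.len a := by
    intro j
    have m1 := L.len_mul a⁻¹ ((a ^ j)⁻¹ * a ^ n * h)
    have m2 := L.len_mul a⁻¹ ((a ^ j)⁻¹ * a ^ (2 * n))
    have m1' := L.len_mul a ((a ^ (j + 1))⁻¹ * a ^ n * h)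
    have m2' := L.len_mul a ((a ^ (j + 1))⁻¹ * a ^ (2 * n))
    have e1 : a * ((a ^ (j + 1))⁻¹ * a ^ n * h) = (a ^ j)⁻¹ * a ^ n * h := by group
    have e2 : a * ((a ^ (j + 1))⁻¹ * a ^ (2 * n)) = (a ^ j)⁻¹ * a ^ (2 * n) := by group
    have e3 : ((a ^ (j + 1))⁻¹ * a ^ n * h)⁻¹ * ((a ^ (j + 1))⁻¹ * a ^ (2 * n)) =
        ((a ^ j)⁻¹ * a ^ n * h)⁻¹ * ((a ^ j)⁻¹ * a ^ (2 * n)) := by group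
    rw [e1] at m1'
    rw [e2] at m2'
    simp only [ψ, gp, e3]
    linarith
  obtain ⟨j, hφj, hψj⟩ : ∃ j, φ j ≤ P + L.δ ∧ ψ j ≤ P + L.δ + L.len a := by
    by_cases hall : ∀ j ≤ 2 * n, φ j ≤ P + L.δ
    · refine ⟨2 * n, hall _ le_rfl, ?_⟩
      have : ψ (2 * n) = 0 := by
        simp only [ψ, gp, inv_mul_cancel, mul_one, L.len_one, L.len_inv]
        ring
      rw [this]
      linarith [L.len_nonneg a]
    · push Not at hall
      classical
      have hex : ∃ j, j ≤ 2 * n ∧ P + L.δ < φ j := hall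
      obtain ⟨hj1, hj2⟩ := Nat.find_spec hex
      have hne : Nat.find hex ≠ 0 := by
        intro h0
        rw [h0] at hj2
        have : φ 0 = 0 := by simp [φ, gp, L.len_one]
        linarith
      obtain ⟨i, hi⟩ := Nat.exists_eq_succ_of_ne_zero hne
      have hlt := Nat.find_min hex (m := i) (by omega)
      push Not at hlt
      refine ⟨i, hlt (by omega), ?_⟩
      rw [hi] at hj1 hj2
      rcases min_le_iff.1 (hmin _ hj1) with h' | h'
      · exact absurd h' (not_le.2 hj2)
      · linarith [hψ i]
  refine ⟨(j : ℤ) - n, ?_⟩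
  have e1 : L.len (h⁻¹ * a ^ ((j : ℤ) - n)) = L.len ((a ^ j)⁻¹ * a ^ n * h) := by
    rw [← L.len_inv (h⁻¹ * a ^ ((j : ℤ) - n))]
    congr 1
    group
  have s1 : φ j + ψ j = L.len ((a ^ j)⁻¹ * a ^ n * h) + L.gp (a ^ j)⁻¹ ((a ^ j)⁻¹ * a ^ (2 * n))
      - L.gp (h⁻¹ * (a ^ n)⁻¹) (h⁻¹ * a ^ n) := by
    have f1 : (a ^ j)⁻¹⁻¹ * ((a ^ j)⁻¹ * a ^ n * h) = (h⁻¹ * (a ^ n)⁻¹)⁻¹ := by group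
    have f2 : ((a ^ j)⁻¹ * a ^ n * h)⁻¹ * ((a ^ j)⁻¹ * a ^ (2 * n)) = h⁻¹ * a ^ n := by
      rw [two_mul, pow_add]
      group
    have f3 : (a ^ j)⁻¹⁻¹ * ((a ^ j)⁻¹ * a ^ (2 * n)) =
        (h⁻¹ * (a ^ n)⁻¹)⁻¹ * (h⁻¹ * a ^ n) := by
      rw [two_mul, pow_add]
      group
    simp only [φ, ψ, gp, f1, f2, f3, L.len_inv]
    ring
  have s2 := L.gp_nonneg (a ^ j)⁻¹ ((a ^ j)⁻¹ * a ^ (2 * n))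
  rw [e1]
  linarith

/-- A homomorphism into the centralizer of `a` is controlled by a quasi-morphism. -/
lemma exists_quasimorphism (ha : L.len a + (3 * L.δ + 1) ≤ L.len (a * a))
    {Δ : Type*} [Group Δ] (f : Δ →* Γ) (hf : ∀ g, Commute a (f g)) :
    ∃ (κ : Δ → ℝ) (D M : ℝ), (∀ g h, |κ (g * h) - κ g - κ h| ≤ D) ∧
      ∀ g, L.len (f g) ≤ |κ g| * L.len a + M := by
  set D := 3 * L.gp a⁻¹ a + 10 * L.δ + L.len a
  choose k hk using fun g => exists_len_inv_mul_zpow_le ha (hf g)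
  refine ⟨fun g => k g, 3 * D, D, fun g h => ?_, fun g => ?_⟩
  · have e := abs_le_len_zpow ha (k (g * h) - k g - k h)
    push_cast at e
    refine e.trans ?_
    have c : f g * (a ^ k h)⁻¹ = (a ^ k h)⁻¹ * f g := (((hf g).zpow_left (k h)).inv_left.eq).symm
    have e2 : a ^ (k (g * h) - k g - k h) =
        ((f g)⁻¹ * a ^ k g)⁻¹ * (((f h)⁻¹ * a ^ k h)⁻¹ * ((f (g * h))⁻¹ * a ^ k (g * h))) := by
      calc a ^ (k (g * h) - k g - k h)
          = (a ^ k g)⁻¹ * ((a ^ k h)⁻¹ * f g) * (f g)⁻¹ * a ^ k (g * h) := by group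
        _ = _ := by rw [← c, map_mul]; group
    have m1 := L.len_mul ((f g)⁻¹ * a ^ k g)⁻¹
      (((f h)⁻¹ * a ^ k h)⁻¹ * ((f (g * h))⁻¹ * a ^ k (g * h)))
    have m2 := L.len_mul ((f h)⁻¹ * a ^ k h)⁻¹ ((f (g * h))⁻¹ * a ^ k (g * h))
    rw [L.len_inv] at m1 m2
    rw [e2]
    linarith [hk g, hk h, hk (g * h)]
  · obtain ⟨n, hn⟩ := (k g).eq_nat_or_neg
    have e : L.len (a ^ k g) ≤ |(k g : ℝ)| * L.len a := by
      rcases hn with hn | hn <;> rw [hn] <;> simpa [L.len_inv] using L.len_pow_le a n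
    have e2 := L.len_mul (a ^ k g) ((f g)⁻¹ * a ^ k g)⁻¹
    have e3 := hk g
    rw [L.len_inv] at e2
    have e4 : a ^ k g * ((f g)⁻¹ * a ^ k g)⁻¹ = f g := by group
    rw [e4] at e2
    linarith

end Axis

end HypLength

/-! ### Quasi-morphisms -/

open Filter Topology in
/-- A quasi-morphism on a group without nontrivial real characters is bounded if some endomorphism
of the group coarsely doubles it. -/
lemma exists_bound_of_doubling {Λ : Type*} [Group Λ] {q : Λ → ℝ} {D E : ℝ}
    (hq : ∀ g h, |q (g * h) - q g - q h| ≤ D) (d : Λ →* Λ) (hd : ∀ g, |q (d g) - 2 * q g| ≤ E)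
    (htriv : ∀ (φ : Λ →* Multiplicative ℝ) (g : Λ), φ g = 1) : ∃ E', ∀ g, |q g| ≤ E' := by
  set s : Λ → ℕ → ℝ := fun g k => q (d^[k] g) / 2 ^ k with hs
  have hstep : ∀ g k, dist (s g k) (s g (k + 1)) ≤ E / 2 / 2 ^ k := by
    intro g k
    have e : s g k - s g (k + 1) = -((q (d (d^[k] g)) - 2 * q (d^[k] g)) / 2 / 2 ^ k) := by
      simp only [hs, Function.iterate_succ_apply', pow_succ]
      field_simp
      ring
    rw [Real.dist_eq, e, abs_neg, abs_div, abs_div, abs_of_pos (by positivity : (0 : ℝ) < 2),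
      abs_of_pos (by positivity : (0 : ℝ) < 2 ^ k)]
    gcongr
    exact hd _
  choose l hl using fun g => cauchySeq_tendsto_of_complete (cauchySeq_of_le_geometric_two (hstep g))
  have hadd : ∀ g h, l (g * h) = l g + l h := by
    intro g h
    have h1 : Tendsto (fun k => s (g * h) k - s g k - s h k) atTop (𝓝 (l (g * h) - l g - l h)) :=
      ((hl _).sub (hl _)).sub (hl _)
    have h2 : Tendsto (fun k => s (g * h) k - s g k - s h k) atTop (𝓝 0) := by
      refine squeeze_zero_norm (a := fun k => D * (1 / 2 : ℝ) ^ k) (fun k => ?_) ?_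
      · have e : s (g * h) k - s g k - s h k =
            (q (d^[k] g * d^[k] h) - q (d^[k] g) - q (d^[k] h)) / 2 ^ k := by
          simp only [hs, iterate_map_mul]
          ring
        rw [Real.norm_eq_abs, e, abs_div, abs_of_pos (by positivity : (0 : ℝ) < 2 ^ k), one_div,
          inv_pow, ← div_eq_mul_inv]
        gcongr
        exact hq _ _
      · simpa using (tendsto_pow_atTop_nhds_zero_of_lt_one (r := (1 / 2 : ℝ)) (by norm_num)
          (by norm_num)).const_mul D
    have := tendsto_nhds_unique h1 h2
    linarith
  refine ⟨E, fun g => ?_⟩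
  have h1 : l g = 0 := by
    have := htriv (MonoidHom.mk' (fun g => Multiplicative.ofAdd (l g)) fun g h => by
      rw [hadd, ofAdd_add]) g
    simpa using this
  have h2 := dist_le_of_le_geometric_two_of_tendsto₀ (hstep g) (hl g)
  rw [h1, Real.dist_eq, sub_zero] at h2
  simpa [hs] using h2

/-! ### Permutations of `ℕ` acting on dyadic cones -/

namespace Cone

open Equiv

lemma inv_apply_self (g : Perm ℕ) (x : ℕ) : g⁻¹ (g x) = x := g.symm_apply_apply x

lemma apply_inv_self (g : Perm ℕ) (x : ℕ) : g (g⁻¹ x) = x := g.apply_symm_apply x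

/-- The bijection of `ℕ` with the cone of the binary word `w`. -/
def cw : List Bool → ℕ → ℕ
  | [], n => n
  | b :: w, n => 2 * cw w n + b.toNat

@[simp] lemma cw_nil (n : ℕ) : cw [] n = n := rfl

lemma cw_cons (b : Bool) (w : List Bool) (n : ℕ) : cw (b :: w) n = 2 * cw w n + b.toNat := rfl

lemma cw_cons_inj {b c : Bool} {u v : List Bool} {y z : ℕ} :
    cw (b :: u) y = cw (c :: v) z ↔ b = c ∧ cw u y = cw v z := by
  cases b <;> cases c <;> simp [cw_cons] <;> omega

lemma cw_append (u v : List Bool) (n : ℕ) : cw (u ++ v) n = cw u (cw v n) := by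
  induction u with
  | nil => rfl
  | cons b u ih => simp [cw_cons, ih]

lemma cw_injective (w : List Bool) : Function.Injective (cw w) := by
  induction w with
  | nil => exact fun _ _ h => h
  | cons b w ih => exact fun x y h => ih (cw_cons_inj.1 h).2

@[simp] lemma cw_inj {w : List Bool} {x y : ℕ} : cw w x = cw w y ↔ x = y :=
  (cw_injective w).eq_iff

lemma exists_cw_eq (k : ℕ) (x : ℕ) : ∃ w y, w.length = k ∧ x = cw w y := by
  induction k generalizing x with
  | zero => exact ⟨[], x, rfl, rfl⟩
  | succ k ih =>
    obtain ⟨w, y, hw, hx⟩ := ih (x / 2)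
    rcases Nat.mod_two_eq_zero_or_one x with h | h
    · exact ⟨false :: w, y, by simp [hw], by simp [cw_cons, ← hx]; omega⟩
    · exact ⟨true :: w, y, by simp [hw], by simp [cw_cons, ← hx]; omega⟩

lemma mem_cone_or (u : List Bool) (x : ℕ) : (∃ y, x = cw u y) ∨ ∀ y, x ≠ cw u y := by
  by_cases h : ∃ y, x = cw u y
  · exact Or.inl h
  · exact Or.inr (not_exists.1 h)

lemma exists_of_not_mem (b : Bool) {x : ℕ} (h : ∀ y, x ≠ cw [b] y) : ∃ y, x = cw [!b] y := by
  obtain ⟨w, y, hw, rfl⟩ := exists_cw_eq 1 x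
  obtain ⟨c, rfl⟩ := List.length_eq_one_iff.1 hw
  have : c ≠ b := by rintro rfl; exact h y rfl
  have : c = !b := by cases b <;> cases c <;> simp_all
  exact ⟨y, by rw [this]⟩

/-- Two words whose cones are disjoint. -/
def Disj (u v : List Bool) : Prop := ∀ y z, cw u y ≠ cw v z

@[simp] lemma not_disj_nil_left (v : List Bool) : ¬ Disj [] v := fun h => h (cw v 0) 0 rfl

@[simp] lemma not_disj_nil_right (v : List Bool) : ¬ Disj v [] := fun h => h 0 (cw v 0) rfl

@[simp] lemma disj_cons {b c : Bool} {u v : List Bool} :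
    Disj (b :: u) (c :: v) ↔ b ≠ c ∨ Disj u v := by
  simp only [Disj, ne_eq, cw_cons_inj]
  by_cases h : b = c <;> simp [h]

lemma Disj.symm {u v : List Bool} (h : Disj u v) : Disj v u := fun y z e => h z y e.symm

lemma Disj.append_right {u v : List Bool} (h : Disj u v) (t : List Bool) : Disj u (v ++ t) :=
  fun y z => by rw [cw_append]; exact h _ _

lemma Disj.append_left {u v : List Bool} (h : Disj u v) (s : List Bool) : Disj (u ++ s) v :=
  (h.symm.append_right s).symm

lemma Disj.append {u v : List Bool} (h : Disj u v) (s t : List Bool) :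
    Disj (u ++ s) (v ++ t) :=
  (h.append_left s).append_right t

@[simp] lemma disj_append_append {u s t : List Bool} : Disj (u ++ s) (u ++ t) ↔ Disj s t := by
  simp [Disj, cw_append]

lemma comparable_or_disj (u v : List Bool) :
    (∃ t, v = u ++ t) ∨ (∃ t, u = v ++ t) ∨ Disj u v := by
  induction u generalizing v with
  | nil => exact Or.inl ⟨v, rfl⟩
  | cons b u ih =>
    cases v with
    | nil => exact Or.inr (Or.inl ⟨b :: u, rfl⟩)
    | cons c v =>
      by_cases h : b = c
      · subst h
        simpa using ih v
      · exact Or.inr (Or.inr (disj_cons.2 (Or.inl h)))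

lemma comparable_of_eq {u v : List Bool} {y z : ℕ} (h : cw u y = cw v z) :
    (∃ t, v = u ++ t) ∨ ∃ t, u = v ++ t := by
  rcases comparable_or_disj u v with h' | h' | h'
  · exact Or.inl h'
  · exact Or.inr h'
  · exact absurd h (h' y z)

lemma exists_append_of_length {u w : List Bool} (h : u.length ≤ w.length) :
    (∃ t, w = u ++ t) ∨ Disj u w := by
  rcases comparable_or_disj u w with h' | ⟨t, rfl⟩ | h'
  · exact Or.inl h'
  · have : t = [] := List.length_eq_zero_iff.1 (by simpa using h)
    exact Or.inl ⟨[], by simp [this]⟩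
  · exact Or.inr h'

/-- The copy of a permutation of `ℕ` acting on the cone of `u`. -/
def σ (u : List Bool) : Perm ℕ →* Perm ℕ := Perm.viaEmbeddingHom ⟨cw u, cw_injective u⟩

@[simp] lemma σ_apply (u : List Bool) (a : Perm ℕ) (y : ℕ) : σ u a (cw u y) = cw u (a y) :=
  Perm.viaEmbedding_apply a ⟨cw u, cw_injective u⟩ y

lemma σ_apply_of_not_mem {u : List Bool} (a : Perm ℕ) {x : ℕ} (h : ∀ y, x ≠ cw u y) :
    σ u a x = x :=
  Perm.viaEmbedding_apply_of_notMem a ⟨cw u, cw_injective u⟩ x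
    (by rintro ⟨y, rfl⟩; exact h y rfl)

lemma σ_apply_of_disj {u v : List Bool} (h : Disj u v) (a : Perm ℕ) (y : ℕ) :
    σ u a (cw v y) = cw v y :=
  σ_apply_of_not_mem a fun z => h.symm y z

lemma σ_injective (u : List Bool) : Function.Injective (σ u) :=
  Perm.viaEmbeddingHom_injective _

lemma σ_apply_append (u v : List Bool) (a : Perm ℕ) (y : ℕ) :
    σ u a (cw (u ++ v) y) = cw u (a (cw v y)) := by
  rw [cw_append, σ_apply]

@[simp] lemma σ_nil (a : Perm ℕ) : σ [] a = a := by
  ext y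
  exact σ_apply [] a y

lemma conj_σ {h k a : Perm ℕ} {u v : List Bool} (hk : ∀ y, h (cw u y) = cw v (k y)) :
    h * σ u a * h⁻¹ = σ v (k * a * k⁻¹) := by
  rw [mul_inv_eq_iff_eq_mul]
  ext x
  rcases mem_cone_or u x with ⟨y, rfl⟩ | hx
  · simp only [Perm.mul_apply, hk, σ_apply, inv_apply_self]
  · rw [Perm.mul_apply, Perm.mul_apply, σ_apply_of_not_mem a hx, σ_apply_of_not_mem]
    intro z hz
    have : h x = h (cw u (k⁻¹ z)) := by rw [hk, apply_inv_self]; exact hz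
    exact hx _ (h.injective this)

lemma conj_σ' {h a : Perm ℕ} {u v : List Bool} (hk : ∀ y, h (cw u y) = cw v y) :
    h * σ u a * h⁻¹ = σ v a := by
  simpa using conj_σ (k := 1) (a := a) hk

lemma σ_append (u v : List Bool) (a : Perm ℕ) : σ (u ++ v) a = σ u (σ v a) := by
  ext x
  rcases mem_cone_or u x with ⟨y, rfl⟩ | hx
  · rcases mem_cone_or v y with ⟨z, rfl⟩ | hy
    · rw [σ_apply, σ_apply, ← cw_append, ← cw_append, σ_apply]
    · rw [σ_apply, σ_apply_of_not_mem _ hy, σ_apply_of_not_mem]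
      simpa [cw_append] using hy
  · rw [σ_apply_of_not_mem _ hx, σ_apply_of_not_mem]
    intro y
    rw [cw_append]
    exact hx _

/-- The pointwise stabilizer of the cone of `w`. -/
def Fix (w : List Bool) : Subgroup (Perm ℕ) where
  carrier := {g | ∀ y, g (cw w y) = cw w y}
  one_mem' _ := rfl
  mul_mem' {g h} hg hh y := by rw [Perm.mul_apply, hh, hg]
  inv_mem' {g} hg y := by rw [Perm.inv_eq_iff_eq, hg]

lemma mem_Fix {w : List Bool} {g : Perm ℕ} : g ∈ Fix w ↔ ∀ y, g (cw w y) = cw w y := Iff.rfl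

lemma Fix_le_append (w t : List Bool) : Fix w ≤ Fix (w ++ t) := fun g hg y => by
  rw [cw_append, hg]

lemma σ_mem_Fix {u w : List Bool} (h : Disj u w) (a : Perm ℕ) : σ u a ∈ Fix w :=
  fun y => σ_apply_of_disj h a y

lemma commute_of_mem_Fix {w : List Bool} {g : Perm ℕ} (hg : g ∈ Fix w) (b : Perm ℕ) :
    Commute g (σ w b) :=
  mul_inv_eq_iff_eq_mul.1 (conj_σ' hg)

lemma commute_σ_σ {u w : List Bool} (h : Disj u w) (a b : Perm ℕ) : Commute (σ u a) (σ w b) :=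
  commute_of_mem_Fix (σ_mem_Fix h a) b

lemma conj_mem_Fix {h g : Perm ℕ} {u v : List Bool} (hk : ∀ y, h (cw u y) = cw v y)
    (hg : g ∈ Fix u) : h * g * h⁻¹ ∈ Fix v := by
  intro y
  rw [← hk, Perm.mul_apply, Perm.mul_apply, inv_apply_self, hg]

open Classical in
/-- The involution exchanging the cones of `u` and `v`, when these are disjoint. -/
def swap (u v : List Bool) : Perm ℕ :=
  if h : Disj u v then
    Perm.viaEmbedding (Equiv.sumComm ℕ ℕ) ⟨Sum.elim (cw u) (cw v),
      (cw_injective u).sumElim (cw_injective v) h⟩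
  else 1

lemma swap_left {u v : List Bool} (h : Disj u v) (y : ℕ) : swap u v (cw u y) = cw v y := by
  rw [swap, dif_pos h]
  exact Perm.viaEmbedding_apply (Equiv.sumComm ℕ ℕ) ⟨Sum.elim (cw u) (cw v), _⟩ (Sum.inl y)

lemma swap_right {u v : List Bool} (h : Disj u v) (y : ℕ) : swap u v (cw v y) = cw u y := by
  rw [swap, dif_pos h]
  exact Perm.viaEmbedding_apply (Equiv.sumComm ℕ ℕ) ⟨Sum.elim (cw u) (cw v), _⟩ (Sum.inr y)

lemma swap_of_not_mem {u v : List Bool} {x : ℕ} (hu : ∀ y, x ≠ cw u y) (hv : ∀ y, x ≠ cw v y) :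
    swap u v x = x := by
  by_cases h : Disj u v
  · rw [swap, dif_pos h]
    refine Perm.viaEmbedding_apply_of_notMem _ _ _ ?_
    rintro ⟨y | y, rfl⟩
    · exact hu y rfl
    · exact hv y rfl
  · rw [swap, dif_neg h, Perm.one_apply]

lemma eq_swap {u v : List Bool} {g : Perm ℕ} (h : Disj u v) (hu : ∀ y, g (cw u y) = cw v y)
    (hv : ∀ y, g (cw v y) = cw u y)
    (hx : ∀ x, (∀ y, x ≠ cw u y) → (∀ y, x ≠ cw v y) → g x = x) : g = swap u v := by
  ext x
  rcases mem_cone_or u x with ⟨y, rfl⟩ | h1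
  · rw [hu, swap_left h]
  · rcases mem_cone_or v x with ⟨y, rfl⟩ | h2
    · rw [hv, swap_right h]
    · rw [hx x h1 h2, swap_of_not_mem h1 h2]

lemma swap_comm (u v : List Bool) : swap u v = swap v u := by
  by_cases h : Disj u v
  · exact eq_swap h.symm (swap_right h) (swap_left h) fun x h1 h2 => swap_of_not_mem h2 h1
  · rw [swap, dif_neg h, swap, dif_neg fun h' => h h'.symm]

@[simp] lemma swap_mul_self (u v : List Bool) : swap u v * swap u v = 1 := by
  by_cases h : Disj u v
  · ext x
    rcases mem_cone_or u x with ⟨y, rfl⟩ | h1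
    · simp [swap_left h, swap_right h]
    · rcases mem_cone_or v x with ⟨y, rfl⟩ | h2
      · simp [swap_left h, swap_right h]
      · simp [swap_of_not_mem h1 h2]
  · rw [swap, dif_neg h, one_mul]

@[simp] lemma swap_inv (u v : List Bool) : (swap u v)⁻¹ = swap u v :=
  inv_eq_of_mul_eq_one_left (swap_mul_self u v)

lemma swap_mem_Fix {u v w : List Bool} (hu : Disj u w) (hv : Disj v w) : swap u v ∈ Fix w :=
  fun y => swap_of_not_mem (fun z => hu.symm y z) fun z => hv.symm y z

lemma σ_swap (u : List Bool) {p q : List Bool} (h : Disj p q) :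
    σ u (swap p q) = swap (u ++ p) (u ++ q) := by
  refine eq_swap (disj_append_append.2 h) (fun y => ?_) (fun y => ?_) fun x h1 h2 => ?_
  · rw [σ_apply_append, swap_left h, cw_append]
  · rw [σ_apply_append, swap_right h, cw_append]
  · rcases mem_cone_or u x with ⟨y, rfl⟩ | hx
    · rw [σ_apply, swap_of_not_mem]
      · intro z hz
        exact h1 z (by rw [hz, cw_append])
      · intro z hz
        exact h2 z (by rw [hz, cw_append])
    · exact σ_apply_of_not_mem _ hx

lemma conj_swap {h : Perm ℕ} {u v u' v' : List Bool} (huv : Disj u v)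
    (hu : ∀ y, h (cw u y) = cw u' y) (hv : ∀ y, h (cw v y) = cw v' y) :
    h * swap u v * h⁻¹ = swap u' v' := by
  have hu' : ∀ y, h⁻¹ (cw u' y) = cw u y := fun y => by rw [Perm.inv_eq_iff_eq, hu]
  have hv' : ∀ y, h⁻¹ (cw v' y) = cw v y := fun y => by rw [Perm.inv_eq_iff_eq, hv]
  refine eq_swap (fun y z e => ?_) (fun y => ?_) (fun y => ?_) fun x h1 h2 => ?_
  · rw [← hu, ← hv] at e
    exact huv y z (h.injective e)
  · rw [Perm.mul_apply, Perm.mul_apply, hu', swap_left huv, hv]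
  · rw [Perm.mul_apply, Perm.mul_apply, hv', swap_right huv, hu]
  · rw [Perm.mul_apply, Perm.mul_apply, swap_of_not_mem, apply_inv_self]
    · intro y e
      exact h1 y (by rw [← hu, ← e, apply_inv_self])
    · intro y e
      exact h2 y (by rw [← hv, ← e, apply_inv_self])

lemma swap_split {u v : List Bool} (h : Disj u v) :
    swap u v = swap (u ++ [false]) (v ++ [false]) * swap (u ++ [true]) (v ++ [true]) := by
  have hff := h.append [false] [false]
  have htt := h.append [true] [true]
  have hc : ∀ y, (∃ z, y = cw [false] z) ∨ ∃ z, y = cw [true] z := fun y =>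
    (mem_cone_or [false] y).imp_right fun h => exists_of_not_mem false h
  have key : ∀ u v, Disj u v → ∀ z, swap (u ++ [true]) (v ++ [true]) (cw (u ++ [false]) z) =
      cw (u ++ [false]) z ∧ swap (u ++ [true]) (v ++ [true]) (cw (v ++ [false]) z) =
      cw (v ++ [false]) z ∧ swap (u ++ [false]) (v ++ [false]) (cw (u ++ [true]) z) =
      cw (u ++ [true]) z ∧ swap (u ++ [false]) (v ++ [false]) (cw (v ++ [true]) z) =
      cw (v ++ [true]) z := by
    intro u v h z
    refine ⟨swap_mem_Fix ?_ ?_ z, swap_mem_Fix ?_ ?_ z, swap_mem_Fix ?_ ?_ z,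
      swap_mem_Fix ?_ ?_ z⟩ <;>
    first | exact h.append _ _ | exact h.symm.append _ _ | simp
  refine (eq_swap h (fun y => ?_) (fun y => ?_) fun x h1 h2 => ?_).symm
  · rcases hc y with ⟨z, rfl⟩ | ⟨z, rfl⟩ <;> rw [← cw_append, ← cw_append, Perm.mul_apply]
    · rw [(key u v h z).1, swap_left hff]
    · rw [swap_left htt, (key u v h z).2.2.2]
  · rcases hc y with ⟨z, rfl⟩ | ⟨z, rfl⟩ <;> rw [← cw_append, ← cw_append, Perm.mul_apply]
    · rw [(key u v h z).2.1, swap_right hff]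
    · rw [swap_right htt, (key u v h z).2.2.1]
  · rw [Perm.mul_apply, swap_of_not_mem (x := x), swap_of_not_mem]
    all_goals intro y; rw [cw_append]
    all_goals first | exact h1 _ | exact h2 _

/-- Thompson's group `V`, generated by the exchanges of disjoint cones. -/
def V : Subgroup (Perm ℕ) := Subgroup.closure {g | ∃ u v, Disj u v ∧ g = swap u v}

lemma swap_mem_V (u v : List Bool) : swap u v ∈ V := by
  by_cases h : Disj u v
  · exact Subgroup.subset_closure ⟨u, v, h, rfl⟩
  · rw [swap, dif_neg h]
    exact one_mem V

lemma σ_mem_V (u : List Bool) {g : Perm ℕ} (hg : g ∈ V) : σ u g ∈ V := by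
  have : V ≤ V.comap (σ u) := by
    refine (Subgroup.closure_le _).2 ?_
    rintro _ ⟨p, q, h, rfl⟩
    simpa [σ_swap u h] using swap_mem_V (u ++ p) (u ++ q)
  exact this hg

lemma exists_mem_V_map {u v : List Bool} (hu : u ≠ []) (hv : v ≠ []) :
    ∃ t ∈ V, ∀ y, t (cw u y) = cw v y := by
  have key : ∀ u v, u ≠ [] → (∃ t, v = u ++ t) → ∃ t ∈ V, ∀ y, t (cw u y) = cw v y := by
    rintro u v hu ⟨t, rfl⟩
    obtain ⟨b, u, rfl⟩ := List.exists_cons_of_ne_nil hu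
    have h1 : Disj (b :: u) [!b] := by simp
    have h2 : Disj [!b] (b :: u ++ t) := by simp
    exact ⟨swap [!b] (b :: u ++ t) * swap (b :: u) [!b],
      mul_mem (swap_mem_V _ _) (swap_mem_V _ _), fun y => by
        rw [Perm.mul_apply, swap_left h1, swap_left h2]⟩
  rcases comparable_or_disj u v with h | h | h
  · exact key u v hu h
  · obtain ⟨t, ht, h⟩ := key v u hv h
    exact ⟨t⁻¹, inv_mem ht, fun y => by rw [Perm.inv_eq_iff_eq, h]⟩
  · exact ⟨swap u v, swap_mem_V u v, swap_left h⟩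

/-- The element of `V` contracting the complement of `[1]` to `[00]`. -/
def shrink : Perm ℕ :=
  swap [true] [false, true] * swap [true] [false, false] * swap [false] [true]

lemma shrink_mem_V : shrink ∈ V :=
  mul_mem (mul_mem (swap_mem_V _ _) (swap_mem_V _ _)) (swap_mem_V _ _)

lemma shrink_false (y : ℕ) : shrink (cw [false] y) = cw [false, false] y := by
  rw [shrink, Perm.mul_apply, Perm.mul_apply, swap_left (by simp), swap_left (by simp)]
  exact swap_mem_Fix (by simp) (by simp) y

lemma shrink_true_true (y : ℕ) : shrink (cw [true, true] y) = cw [true] y := by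
  have h1 : swap [false] [true] (cw [true, true] y) = cw [false, true] y :=
    swap_right (by simp) (cw [true] y)
  rw [shrink, Perm.mul_apply, Perm.mul_apply, h1,
    swap_mem_Fix (w := [false, true]) (by simp) (by simp) y, swap_right (by simp)]

lemma exists_mem_V_contract {u w : List Bool} (hu : u ≠ []) (hw : w ≠ []) :
    ∃ v ∈ V, ∀ y, (∀ z, y ≠ cw w z) → v y = cw u y := by
  obtain ⟨s, hs, hs'⟩ := exists_mem_V_map hw (v := [true]) (by simp)
  obtain ⟨t, ht, ht'⟩ := exists_mem_V_map (u := [false]) (by simp) hu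
  refine ⟨t * σ [false] s⁻¹ * shrink * s, mul_mem (mul_mem (mul_mem ht
    (σ_mem_V _ (inv_mem hs))) shrink_mem_V) hs, fun y hy => ?_⟩
  obtain ⟨z, hz⟩ := exists_of_not_mem true (x := s y) (by
    intro z hz
    rw [← hs'] at hz
    exact hy z (s.injective hz))
  have : shrink (s y) = cw [false] (s y) := by
    rw [hz]
    exact shrink_false z
  simp only [Perm.mul_apply, this, σ_apply, inv_apply_self, ht']

lemma conj_contract {u w : List Bool} {v g : Perm ℕ}
    (hv : ∀ y, (∀ z, y ≠ cw w z) → v y = cw u y) (hg : g ∈ Fix w) :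
    v * g * v⁻¹ = σ u g := by
  rw [mul_inv_eq_iff_eq_mul]
  ext y
  rw [Perm.mul_apply, Perm.mul_apply]
  rcases mem_cone_or w y with ⟨z, rfl⟩ | hy
  · rw [hg]
    rcases mem_cone_or u (v (cw w z)) with ⟨x, hx⟩ | hx
    · rcases mem_cone_or w x with ⟨x', rfl⟩ | hx'
      · rw [hx, σ_apply, hg]
      · rw [← hv x hx'] at hx
        exact absurd (v.injective hx).symm (hx' z)
    · rw [σ_apply_of_not_mem g hx]
  · rw [hv y hy, σ_apply, hv]
    intro z hz
    rw [← hg z] at hz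
    exact hy z (g.injective hz)

/-- A permutation is locally a similarity if every point has a cone around it that is mapped
canonically to another cone. -/
def LocSim : Subgroup (Perm ℕ) where
  carrier := {g | ∀ x, ∃ u v y, x = cw u y ∧ ∀ z, g (cw u z) = cw v z}
  one_mem' x := ⟨[], [], x, rfl, fun _ => rfl⟩
  mul_mem' {g h} hg hh x := by
    obtain ⟨u, v, y, rfl, h1⟩ := hh x
    obtain ⟨u', v', y', e, h2⟩ := hg (cw v y)
    rcases comparable_of_eq e with ⟨t, rfl⟩ | ⟨t, rfl⟩
    · rw [cw_append, cw_inj] at e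
      refine ⟨u ++ t, v', y', by rw [cw_append, e], fun z => ?_⟩
      rw [Perm.mul_apply, cw_append, h1, ← cw_append, h2]
    · refine ⟨u, v' ++ t, y, rfl, fun z => ?_⟩
      rw [Perm.mul_apply, h1, cw_append, h2, cw_append]
  inv_mem' {g} hg x := by
    obtain ⟨u, v, y, e, h⟩ := hg (g⁻¹ x)
    refine ⟨v, u, y, ?_, fun z => ?_⟩
    · rw [← h, ← e, apply_inv_self]
    · rw [← h, inv_apply_self]

lemma mem_LocSim {g : Perm ℕ} :
    g ∈ LocSim ↔ ∀ x, ∃ u v y, x = cw u y ∧ ∀ z, g (cw u z) = cw v z := Iff.rfl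

lemma σ_mem_LocSim (w : List Bool) {a : Perm ℕ} (ha : a ∈ LocSim) : σ w a ∈ LocSim := by
  intro x
  rcases mem_cone_or w x with ⟨y, rfl⟩ | hx
  · obtain ⟨u, v, z, rfl, h⟩ := ha y
    refine ⟨w ++ u, w ++ v, z, by rw [cw_append], fun z => ?_⟩
    rw [cw_append, σ_apply, h, cw_append]
  · obtain ⟨t, y, ht, rfl⟩ := exists_cw_eq w.length x
    rcases exists_append_of_length ht.ge with ⟨s, rfl⟩ | h
    · exact absurd (cw_append w s y) (hx _)
    · exact ⟨t, t, y, rfl, σ_apply_of_disj h a⟩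

lemma swap_mem_LocSim (u v : List Bool) : swap u v ∈ LocSim := by
  by_cases h : Disj u v
  swap
  · rw [swap, dif_neg h]
    exact one_mem _
  intro x
  obtain ⟨t, y, ht, rfl⟩ := exists_cw_eq (u.length + v.length) x
  rcases exists_append_of_length (show u.length ≤ t.length by omega) with ⟨s, rfl⟩ | h1
  · exact ⟨u ++ s, v ++ s, y, rfl, fun z => by rw [cw_append, swap_left h, cw_append]⟩
  rcases exists_append_of_length (show v.length ≤ t.length by omega) with ⟨s, rfl⟩ | h2
  · exact ⟨v ++ s, u ++ s, y, rfl, fun z => by rw [cw_append, swap_right h, cw_append]⟩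
  · exact ⟨t, t, y, rfl, swap_mem_Fix h1 h2⟩

lemma exists_tame {g : Perm ℕ} (hg : g ∈ LocSim) (w : List Bool) :
    ∃ t v, ∀ z, g (cw (w ++ t) z) = cw v z := by
  obtain ⟨u, v, y, e, h⟩ := hg (cw w 0)
  rcases comparable_of_eq e with ⟨t, rfl⟩ | ⟨t, rfl⟩
  · exact ⟨t, v, h⟩
  · exact ⟨[], v ++ t, fun z => by rw [List.append_nil, cw_append, h, cw_append]⟩

/-- The word `1ⁿ0`. -/
def zw (n : ℕ) : List Bool := List.replicate n true ++ [false]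

lemma zw_zero : zw 0 = [false] := rfl

lemma zw_succ (n : ℕ) : zw (n + 1) = true :: zw n := rfl

lemma cw_zw_bijective : Function.Bijective fun p : ℕ × ℕ => cw (zw p.1) p.2 := by
  constructor
  · rintro ⟨m, x⟩ ⟨n, y⟩ h
    dsimp only at h
    induction m generalizing n with
    | zero =>
      cases n with
      | zero => simpa using h
      | succ n =>
        rw [zw_zero, zw_succ, cw_cons_inj] at h
        simp at h
    | succ m ih =>
      cases n with
      | zero =>
        rw [zw_zero, zw_succ, cw_cons_inj] at h
        simp at h
      | succ n =>
        rw [zw_succ, zw_succ, cw_cons_inj] at h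
        simpa using ih n h.2
  · intro x
    induction x using Nat.strong_induction_on with
    | _ x ih =>
      rcases Nat.even_or_odd' x with ⟨m, rfl | rfl⟩
      · exact ⟨(0, m), by simp [zw_zero, cw_cons]⟩
      · obtain ⟨⟨n, y⟩, h⟩ := ih m (by omega)
        exact ⟨(n + 1, y), by simpa [zw_succ, cw_cons] using h⟩

/-- The partition of `ℕ` into the cones of the words `1ⁿ0`. -/
def partition : ℕ × ℕ ≃ ℕ := Equiv.ofBijective _ cw_zw_bijective

lemma exists_cw_zw (x : ℕ) : ∃ n y, x = cw (zw n) y := by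
  obtain ⟨⟨n, y⟩, h⟩ := cw_zw_bijective.2 x
  exact ⟨n, y, h.symm⟩

lemma ext_zw {g h : Perm ℕ} (H : ∀ n y, g (cw (zw n) y) = h (cw (zw n) y)) : g = h := by
  ext x
  obtain ⟨n, y, rfl⟩ := exists_cw_zw x
  exact H n y

/-- The permutation acting as `f n` on the cone of `1ⁿ0`. -/
def diag (f : ℕ → Perm ℕ) : Perm ℕ :=
  (partition.symm.trans (Equiv.prodCongrRight f)).trans partition

@[simp] lemma diag_apply (f : ℕ → Perm ℕ) (n y : ℕ) :
    diag f (cw (zw n) y) = cw (zw n) (f n y) := by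
  have : partition.symm (cw (zw n) y) = (n, y) := partition.symm_apply_apply (n, y)
  simp only [diag, Equiv.trans_apply, this]
  rfl

/-- The permutation of the cones of the words `1ⁿ0` induced by a permutation of `ℕ`. -/
def permCones : Perm ℕ →* Perm ℕ :=
  MonoidHom.mk' (fun π => (partition.symm.trans (π.prodCongr (Equiv.refl ℕ))).trans partition)
    fun π ρ => by ext x; simp [Prod.map]

@[simp] lemma permCones_apply (π : Perm ℕ) (n y : ℕ) :
    permCones π (cw (zw n) y) = cw (zw (π n)) y := by
  have : partition.symm (cw (zw n) y) = (n, y) := partition.symm_apply_apply (n, y)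
  simp only [permCones, MonoidHom.mk'_apply, Equiv.trans_apply, this]
  rfl

lemma permCones_injective : Function.Injective permCones := by
  intro π ρ h
  ext n
  have h1 := DFunLike.congr_fun h (cw (zw n) 0)
  rw [permCones_apply, permCones_apply] at h1
  exact (Prod.ext_iff.1 (@cw_zw_bijective.1 (π n, 0) (ρ n, 0) h1)).1

lemma diag_mem_LocSim {f : ℕ → Perm ℕ} (hf : ∀ n, f n ∈ LocSim) : diag f ∈ LocSim := by
  intro x
  obtain ⟨n, y, rfl⟩ := exists_cw_zw x
  obtain ⟨u, v, z, rfl, h⟩ := hf n y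
  exact ⟨zw n ++ u, zw n ++ v, z, by rw [cw_append], fun z => by
    rw [cw_append, diag_apply, h, cw_append]⟩

lemma permCones_mem_LocSim (π : Perm ℕ) : permCones π ∈ LocSim := by
  intro x
  obtain ⟨n, y, rfl⟩ := exists_cw_zw x
  exact ⟨zw n, zw (π n), y, rfl, permCones_apply π n⟩

lemma diag_const (p : Perm ℕ) :
    diag (fun _ => p) = σ [false] p * σ [true] (diag fun _ => p) := by
  have h01 : Disj [false] [true] := by simp
  refine ext_zw fun n y => ?_
  rw [diag_apply]
  cases n with
  | zero => rw [zw_zero, Perm.mul_apply, σ_apply_of_disj h01.symm, σ_apply]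
  | succ n =>
    have e : ∀ z, cw (zw (n + 1)) z = cw [true] (cw (zw n) z) := fun z => cw_append [true] (zw n) z
    rw [e, e, Perm.mul_apply, σ_apply, diag_apply, σ_apply_of_disj h01]

section Group

variable (gm : ℕ → Perm ℕ)

/-- The permutation of `ℕ` encoding `gm m` on the cone of `1ᵐ0`. -/
def code (m : ℕ) : Perm ℕ := σ [true] (diag fun _ => permCones (gm m))

/-- The generator of the group which encodes the whole sequence `gm`. -/
def gen : Perm ℕ := σ [false, false] (diag (code gm)) * (σ [false, true] (diag (code gm)))⁻¹

/-- The finitely generated simple group containing all `gm m`. -/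
def Γ : Subgroup (Perm ℕ) := V ⊔ Subgroup.closure {gen gm}

lemma V_le_Γ : V ≤ Γ gm := le_sup_left

lemma gen_mem_Γ : gen gm ∈ Γ gm :=
  (le_sup_right : _ ≤ Γ gm) (Subgroup.mem_closure_singleton_self _)

variable {gm}

lemma Γ_le {H : Subgroup (Perm ℕ)} (hV : ∀ u v, Disj u v → swap u v ∈ H) (hg : gen gm ∈ H) :
    Γ gm ≤ H := by
  refine sup_le ((Subgroup.closure_le _).2 ?_) ((Subgroup.closure_le _).2 (by simpa using hg))
  rintro _ ⟨u, v, h, rfl⟩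
  exact hV u v h

lemma gen_mem_Fix : gen gm ∈ Fix [true] :=
  mul_mem (σ_mem_Fix (by simp) _) (inv_mem (σ_mem_Fix (by simp) _))

lemma Γ_le_LocSim : Γ gm ≤ LocSim := by
  have h : diag (code gm) ∈ LocSim := diag_mem_LocSim fun m =>
    σ_mem_LocSim _ (diag_mem_LocSim fun _ => permCones_mem_LocSim _)
  exact Γ_le (fun u v _ => swap_mem_LocSim u v)
    (mul_mem (σ_mem_LocSim _ h) (inv_mem (σ_mem_LocSim _ h)))

lemma exists_mem_Γ_conj {u w : List Bool} (hu : u ≠ []) (hw : w ≠ []) :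
    ∃ v ∈ Γ gm, (∀ y, (∀ z, y ≠ cw w z) → v y = cw u y) ∧
      ∀ g ∈ Fix w, v * g * v⁻¹ = σ u g := by
  obtain ⟨v, hv, hv'⟩ := exists_mem_V_contract hu hw
  exact ⟨v, V_le_Γ gm hv, hv', fun g => conj_contract hv'⟩

lemma σ_mem_Γ (u : List Bool) {g : Perm ℕ} (hg : g ∈ Γ gm) : σ u g ∈ Γ gm := by
  rcases eq_or_ne u [] with rfl | hu
  · rwa [σ_nil]
  have : Γ gm ≤ (Γ gm).comap (σ u) := by
    refine Γ_le (fun p q h => V_le_Γ gm (σ_mem_V u (swap_mem_V p q))) ?_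
    obtain ⟨v, hv, -, h⟩ := exists_mem_Γ_conj (gm := gm) hu (w := [true]) (by simp)
    rw [Subgroup.mem_comap, ← h _ gen_mem_Fix]
    exact mul_mem (mul_mem hv (gen_mem_Γ gm)) (inv_mem hv)
  exact this hg

lemma exists_mem_Γ_map {u v : List Bool} (hu : u ≠ []) (hv : v ≠ []) :
    ∃ t ∈ Γ gm, ∀ y, t (cw u y) = cw v y := by
  obtain ⟨t, ht, h⟩ := exists_mem_V_map hu hv
  exact ⟨t, V_le_Γ gm ht, h⟩

lemma code_conj_shrink (m : ℕ) :
    code gm m * shrink⁻¹ * (code gm m)⁻¹ * shrink =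
      σ [true, false] (permCones (gm m)) := by
  set d := diag fun _ => permCones (gm m) with hd
  have h1 : shrink⁻¹ * (σ [true] d⁻¹) * shrink⁻¹⁻¹ = σ [true, true] d⁻¹ :=
    conj_σ' fun y => by rw [Perm.inv_eq_iff_eq, shrink_true_true]
  have h2 : d * (σ [true] d)⁻¹ = σ [false] (permCones (gm m)) := by
    rw [mul_inv_eq_iff_eq_mul]
    exact diag_const _
  have h3 : code gm m = σ [true] d := rfl
  rw [mul_assoc (code gm m), mul_assoc (code gm m), h3, ← map_inv]
  rw [inv_inv] at h1
  rw [h1, show [true, true] = [true] ++ [true] from rfl,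
    show [true, false] = [true] ++ [false] from rfl, σ_append, σ_append, ← map_mul, map_inv, h2]

lemma σ_permCones_mem_Γ (m : ℕ) : σ [false] (permCones (gm m)) ∈ Γ gm := by
  have hB : σ ([false, false] ++ zw m) shrink⁻¹ ∈ Γ gm :=
    σ_mem_Γ _ (V_le_Γ gm (inv_mem shrink_mem_V))
  have h1 : gen gm * σ ([false, false] ++ zw m) shrink⁻¹ * (gen gm)⁻¹ =
      σ ([false, false] ++ zw m) (code gm m * shrink⁻¹ * (code gm m)⁻¹) := by
    refine conj_σ fun y => ?_
    have h2 : (σ [false, true] (diag (code gm)))⁻¹ ∈ Fix ([false, false] ++ zw m) :=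
      inv_mem (σ_mem_Fix (by simp) _)
    rw [gen, Perm.mul_apply, h2, σ_apply_append, diag_apply, cw_append]
  have h3 : σ ([false, false] ++ zw m ++ [true, false]) (permCones (gm m)) ∈ Γ gm := by
    rw [σ_append, ← code_conj_shrink, map_mul, ← h1, ← inv_inv (σ _ shrink), ← map_inv]
    exact mul_mem (mul_mem (mul_mem (gen_mem_Γ gm) hB) (inv_mem (gen_mem_Γ gm))) (inv_mem hB)
  obtain ⟨t, ht, h⟩ := exists_mem_Γ_map (gm := gm)
    (u := [false, false] ++ zw m ++ [true, false]) (v := [false]) (by simp) (by simp)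
  rw [← conj_σ' h]
  exact mul_mem (mul_mem ht h3) (inv_mem ht)

/-- The exchanges of cones of words of length at most three. -/
def shortSwaps : Set (Perm ℕ) := {g | ∃ u v, u.length ≤ 3 ∧ v.length ≤ 3 ∧ g = swap u v}

lemma shortSwaps_finite : shortSwaps.Finite := by
  have h := List.finite_length_le Bool 3
  refine ((h.prod h).image fun p => swap p.1 p.2).subset ?_
  rintro _ ⟨u, v, hu, hv, rfl⟩
  exact ⟨(u, v), ⟨hu, hv⟩, rfl⟩

lemma swap_mem_closure_shortSwaps (n : ℕ) (u v : List Bool) (h : Disj u v)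
    (hn : u.length + v.length = n) : swap u v ∈ Subgroup.closure shortSwaps := by
  induction n using Nat.strong_induction_on generalizing u v with
  | _ n ih =>
  wlog hle : v.length ≤ u.length generalizing u v
  · rw [swap_comm]
    exact this v u h.symm (by omega) (by omega)
  by_cases hu : u.length ≤ 3
  · exact Subgroup.subset_closure ⟨u, v, hu, by omega, rfl⟩
  obtain ⟨a, b, c, t, rfl⟩ : ∃ a b c t, u = [a, b, c] ++ t := by
    match u, hu with
    | a :: b :: c :: t, _ => exact ⟨a, b, c, t, rfl⟩
    | [], hu | [_], hu | [_, _], hu => simp at hu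
  obtain ⟨x, v', rfl⟩ : ∃ x v', v = x :: v' := List.exists_cons_of_ne_nil (by rintro rfl; simp at h)
  obtain ⟨r, hr, hr1, hr2⟩ : ∃ r : List Bool, r.length = 2 ∧ Disj [a, b, c] r ∧ Disj (x :: v') r := by
    by_cases hx : x = a
    · exact ⟨[!a, false], rfl, by simp, by simp [hx]⟩
    · exact ⟨[a, !b], rfl, by simp, by simp [hx]⟩
  have hs : swap [a, b, c] r ∈ Subgroup.closure shortSwaps :=
    Subgroup.subset_closure ⟨_, _, by simp, by omega, rfl⟩
  have hl : ∀ s y, swap [a, b, c] r (cw ([a, b, c] ++ s) y) = cw (r ++ s) y := fun s y => by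
    rw [cw_append, swap_left hr1, cw_append]
  have hconj : ∀ p q, swap [a, b, c] r * swap ([a, b, c] ++ t) (x :: v') * (swap [a, b, c] r)⁻¹ =
      swap p q → swap p q ∈ Subgroup.closure shortSwaps →
      swap ([a, b, c] ++ t) (x :: v') ∈ Subgroup.closure shortSwaps := by
    intro p q e hpq
    rw [← e] at hpq
    have := mul_mem (mul_mem (inv_mem hs) hpq) hs
    simpa only [mul_assoc, inv_mul_cancel_left, inv_mul_cancel, mul_one] using this
  rcases comparable_or_disj [a, b, c] (x :: v') with ⟨s, hs'⟩ | ⟨s, hs'⟩ | h'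
  · rw [hs'] at h hn hconj ⊢
    refine hconj _ _ (conj_swap h (hl t) (hl s)) (ih _ ?_ _ _ ?_ rfl)
    · simp only [List.length_append, hr, List.length_cons] at hn ⊢
      omega
    · simpa using h
  · rw [hs', List.append_assoc] at h
    nth_rewrite 2 [← List.append_nil (x :: v')] at h
    rw [disj_append_append] at h
    simp at h
  · refine hconj _ _ (conj_swap h (hl t) (swap_mem_Fix h' hr2.symm)) (ih _ ?_ _ _ ?_ rfl)
    · simp only [List.length_append, hr, List.length_cons] at hn ⊢
      omega
    · exact hr2.symm.append_left t

lemma Γ_fg : Group.FG (Γ gm) := by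
  rw [Group.fg_iff_subgroup_fg, Subgroup.fg_iff]
  refine ⟨shortSwaps ∪ {gen gm}, le_antisymm ?_ ?_, shortSwaps_finite.union (Set.finite_singleton _)⟩
  · rw [Subgroup.closure_le]
    rintro _ (⟨u, v, -, -, rfl⟩ | rfl)
    · exact V_le_Γ gm (swap_mem_V u v)
    · exact gen_mem_Γ gm
  · refine Γ_le (fun u v h => ?_) (Subgroup.subset_closure (Or.inr rfl))
    exact Subgroup.closure_mono Set.subset_union_left (swap_mem_closure_shortSwaps _ u v h rfl)

lemma exists_mem_map_disj {N : Subgroup (Perm ℕ)} (hle : N ≤ Γ gm) (hne : N ≠ ⊥) :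
    ∃ u v, Disj u v ∧ ∃ n ∈ N, ∀ y, n (cw u y) = cw v y := by
  obtain ⟨⟨n, hn⟩, hn1⟩ := N.ne_bot_iff_exists_ne_one.1 hne
  obtain ⟨x, hx⟩ : ∃ x, n x ≠ x := by
    by_contra! hall
    exact hn1 (Subtype.ext (Equiv.ext hall))
  obtain ⟨u, v, y, rfl, h⟩ := Γ_le_LocSim (hle hn) x
  have happ : ∀ s z, n (cw (u ++ s) z) = cw (v ++ s) z := fun s z => by
    rw [cw_append, h, cw_append]
  rcases comparable_or_disj u v with ⟨t, rfl⟩ | ⟨t, rfl⟩ | h'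
  · cases t with
    | nil => exact absurd (by simpa using h y) hx
    | cons b t => exact ⟨_, _, by simp, n, hn, happ [!b]⟩
  · cases t with
    | nil => exact absurd (by simpa using h y) hx
    | cons b t => exact ⟨_, _, by simp, n, hn, happ [!b]⟩
  · exact ⟨u, v, h', n, hn, h⟩

section Simple

variable {N : Subgroup (Perm ℕ)}

lemma mem_of_conj_mem (hN : ∀ g ∈ Γ gm, ∀ n ∈ N, g * n * g⁻¹ ∈ N)
    {g h : Perm ℕ} (hg : g ∈ Γ gm) (h' : g * h * g⁻¹ ∈ N) : h ∈ N := by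
  have := hN g⁻¹ (inv_mem hg) _ h'
  simpa only [mul_assoc, inv_mul_cancel_left, inv_inv, inv_mul_cancel, mul_one] using this

lemma σ_comm_mem (hN : ∀ g ∈ Γ gm, ∀ n ∈ N, g * n * g⁻¹ ∈ N)
    {u v : List Bool} (huv : Disj u v) {n : Perm ℕ} (hn : n ∈ N)
    (h : ∀ y, n (cw u y) = cw v y) {a b : Perm ℕ} (ha : a ∈ Γ gm) (hb : b ∈ Γ gm) {w : List Bool}
    (hw : w ≠ []) : σ w (a⁻¹ * (b * a * b⁻¹)) ∈ N := by
  have hu : u ≠ [] := by rintro rfl; simp at huv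
  have hA := σ_mem_Γ u ha
  have hB := σ_mem_Γ u hb
  have h1 : n * (σ u a * n⁻¹ * (σ u a)⁻¹) ∈ N := mul_mem hn (hN _ hA _ (inv_mem hn))
  have h2 := mul_mem h1 (hN _ hB _ (inv_mem h1))
  have e1 : n * (σ u a * n⁻¹ * (σ u a)⁻¹) = σ v a * (σ u a)⁻¹ := by
    rw [← conj_σ' (a := a) h]
    group
  have c : Commute (σ v a) (σ u (a⁻¹ * b * a)) := commute_σ_σ huv.symm _ _
  have e2 : n * (σ u a * n⁻¹ * (σ u a)⁻¹) *
      (σ u b * (n * (σ u a * n⁻¹ * (σ u a)⁻¹))⁻¹ * (σ u b)⁻¹) = σ u (a⁻¹ * (b * a * b⁻¹)) := by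
    calc _ = σ v a * σ u (a⁻¹ * b * a) * (σ v a)⁻¹ * (σ u b)⁻¹ := by
          rw [e1]
          simp only [map_mul, map_inv]
          group
      _ = _ := by
          rw [c.eq, mul_inv_cancel_right, ← map_inv, ← map_mul]
          group
  rw [e2] at h2
  obtain ⟨t, ht, ht'⟩ := exists_mem_Γ_map (gm := gm) hu hw
  rw [← conj_σ' ht']
  exact hN t ht _ h2

lemma Γ_le_of_normal (hN : ∀ g ∈ Γ gm, ∀ n ∈ N, g * n * g⁻¹ ∈ N)
    (hle : N ≤ Γ gm) (hne : N ≠ ⊥) : Γ gm ≤ N := by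
  obtain ⟨u, v, huv, n, hn, h⟩ := exists_mem_map_disj hle hne
  have hsame : ∀ b p q, Disj p q → swap (b :: p) (b :: q) ∈ N := by
    intro b p q hpq
    have h00 : Disj (p ++ [false]) (q ++ [false]) := hpq.append _ _
    have hp : Disj (p ++ [false]) (p ++ [true]) := by simp
    have hq : Disj (q ++ [false]) (q ++ [true]) := by simp
    have e : (swap (p ++ [false]) (q ++ [false]))⁻¹ *
        (swap (p ++ [false]) (p ++ [true]) * swap (q ++ [false]) (q ++ [true]) *
        swap (p ++ [false]) (q ++ [false]) *
        (swap (p ++ [false]) (p ++ [true]) * swap (q ++ [false]) (q ++ [true]))⁻¹) = swap p q := by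
      rw [swap_split hpq, swap_inv]
      congr 1
      refine conj_swap h00 (fun y => ?_) (fun y => ?_)
      · rw [Perm.mul_apply, swap_mem_Fix (h00.symm) ((hpq.append _ _).symm), swap_left hp]
      · rw [Perm.mul_apply, swap_left hq, swap_mem_Fix (hpq.append _ _) (hpq.append _ _)]
    have := σ_comm_mem hN huv hn h (a := swap (p ++ [false]) (q ++ [false]))
      (b := swap (p ++ [false]) (p ++ [true]) * swap (q ++ [false]) (q ++ [true]))
      (V_le_Γ gm (swap_mem_V _ _)) (V_le_Γ gm (mul_mem (swap_mem_V _ _) (swap_mem_V _ _)))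
      (w := [b]) (by simp)
    rw [e, σ_swap _ hpq] at this
    exact this
  have hdiff : ∀ b d p c q, b ≠ c → swap (b :: d :: p) (c :: q) ∈ N := by
    intro b d p c q hbc
    have h1 : Disj [b, !d] (c :: q) := by simp [hbc]
    refine mem_of_conj_mem hN (V_le_Γ gm (swap_mem_V [b, !d] (c :: q))) ?_
    rw [conj_swap (u' := b :: d :: p) (v' := [b, !d]) (by simp [hbc])
      (swap_mem_Fix (by simp) (by simp [hbc.symm])) (swap_right h1)]
    exact hsame b _ _ (by simp)
  have hswap : ∀ u v, Disj u v → swap u v ∈ N := by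
    intro u v h
    match u, v, h with
    | [], _, h => simp at h
    | _ :: _, [], h => simp at h
    | b :: p, c :: q, h =>
      by_cases hbc : b = c
      · subst hbc
        exact hsame b p q (by simpa using h)
      · match p, q, h with
        | d :: p, q, _ => exact hdiff b d p c q hbc
        | p, d :: q, _ =>
          rw [swap_comm]
          exact hdiff c d q b p (Ne.symm hbc)
        | [], [], h =>
          rw [swap_split h]
          exact mul_mem (hdiff b _ _ c _ hbc) (hdiff b _ _ c _ hbc)
  refine Γ_le hswap ?_
  set F := diag (code gm) with hF
  have m1 := hswap [false, true] [true, false] (by simp)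
  have m2 := hswap [false, false] [true, false] (by simp)
  set h₁ := swap [false, true] [true, false]
  set h₂ := swap [false, false] [true, false]
  have e1 : h₁ * gen gm * h₁⁻¹ = σ [false, false] F * (σ [true, false] F)⁻¹ := by
    rw [gen, ← conj_mul, ← conj_inv, conj_σ' (v := [false, false]) (swap_mem_Fix (by simp) (by simp)),
      conj_σ' (v := [true, false]) (swap_left (by simp))]
  have e2 : h₂ * gen gm * h₂⁻¹ = σ [true, false] F * (σ [false, true] F)⁻¹ := by
    rw [gen, ← conj_mul, ← conj_inv, conj_σ' (v := [false, true]) (swap_mem_Fix (by simp) (by simp)),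
      conj_σ' (v := [true, false]) (swap_left (by simp))]
  have e3 : gen gm = h₁ * gen gm * h₁⁻¹ * (h₂ * gen gm * h₂⁻¹) := by
    rw [e1, e2, gen, ← hF]
    group
  have e4 : gen gm = (h₁⁻¹ * h₂)⁻¹ * ((gen gm)⁻¹ * h₁⁻¹ * (gen gm)⁻¹⁻¹) * h₂ := by
    have e5 : (gen gm)⁻¹ * h₁⁻¹ * gen gm = h₁⁻¹ * h₂ * gen gm * h₂⁻¹ := by
      nth_rewrite 2 [e3]
      group
    rw [inv_inv, e5]
    group
  rw [e4]
  exact mul_mem (mul_mem (inv_mem (mul_mem (inv_mem m1) m2))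
    (hN _ (inv_mem (gen_mem_Γ gm)) _ (inv_mem m1))) m2

end Simple

lemma eq_top_of_normal (H : Subgroup (Γ gm)) [H.Normal] (hH : H ≠ ⊥) : H = ⊤ := by
  have h := Γ_le_of_normal (gm := gm) (N := H.map (Γ gm).subtype) (by
      rintro g hg _ ⟨n, hn, rfl⟩
      exact ⟨⟨g, hg⟩ * n * ⟨g, hg⟩⁻¹, Subgroup.Normal.conj_mem ‹_› n hn _, rfl⟩)
    (Subgroup.map_subtype_le H) (by
      rwa [Ne, Subgroup.map_eq_bot_iff_of_injective _ (Γ gm).subtype_injective])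
  rw [eq_top_iff]
  rintro ⟨g, hg⟩ -
  obtain ⟨n, hn, e⟩ := h hg
  have : n = ⟨g, hg⟩ := Subtype.ext e
  rwa [← this]

lemma exists_not_commute : ∃ a b : Γ gm, b * a * b⁻¹ * a⁻¹ ≠ 1 := by
  refine ⟨⟨_, V_le_Γ gm (swap_mem_V [false, false] [false, true])⟩,
    ⟨_, V_le_Γ gm (swap_mem_V [false] [true])⟩, fun h => ?_⟩
  have h1 : swap [false] [true] * swap [false, false] [false, true] * (swap [false] [true])⁻¹ =
      swap [false, false] [false, true] := by
    rw [mul_inv_eq_one] at h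
    exact congrArg Subtype.val h
  rw [conj_swap (u' := [true, false]) (v' := [true, true]) (by simp)
    (fun y => swap_left (u := [false]) (by simp) (cw [false] y))
    (fun y => swap_left (u := [false]) (by simp) (cw [true] y))] at h1
  have h2 := DFunLike.congr_fun h1 (cw [false, false] 0)
  rw [swap_left (by simp), swap_mem_Fix (by simp) (by simp) 0] at h2
  simp [cw_cons] at h2

lemma Γ_isSimpleGroup : IsSimpleGroup (Γ gm) where
  exists_pair_ne := by
    obtain ⟨a, b, h⟩ := exists_not_commute (gm := gm)
    exact ⟨_, _, h⟩
  eq_bot_or_eq_top_of_normal H _ := or_iff_not_imp_left.2 (eq_top_of_normal H)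

lemma hom_apply_eq_one {A : Type*} [CommGroup A] (φ : Γ gm →* A) (g : Γ gm) : φ g = 1 := by
  have h : φ.ker = ⊤ := eq_top_of_normal _ fun h => by
    obtain ⟨a, b, hab⟩ := exists_not_commute (gm := gm)
    refine hab ((Subgroup.eq_bot_iff_forall _).1 h _ ?_)
    simp [MonoidHom.mem_ker, mul_comm (φ b)]
  exact MonoidHom.mem_ker.1 (h ▸ Subgroup.mem_top g)

/-- Every element is a product of three elements fixing cones of words of length two. -/
lemma exists_eq_mul_mul {g : Perm ℕ} (hg : g ∈ Γ gm) :
    ∃ w₁ w₂ w₃ : List Bool, w₁.length = 2 ∧ w₂.length = 2 ∧ w₃.length = 2 ∧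
      ∃ s₁ ∈ Γ gm ⊓ Fix w₁, ∃ s₂ ∈ Γ gm ⊓ Fix w₂, ∃ s₃ ∈ Γ gm ⊓ Fix w₃, g = s₁ * s₂ * s₃ := by
  obtain ⟨t, v, h⟩ : ∃ t v, 2 ≤ v.length ∧ ∀ z, g (cw ([true] ++ t) z) = cw v z := by
    obtain ⟨t, v, h⟩ := exists_tame (Γ_le_LocSim hg) [true]
    refine ⟨t ++ [false, false], v ++ [false, false], by simp, fun z => ?_⟩
    rw [← List.append_assoc, cw_append, h, cw_append]
  obtain ⟨a, b, v, rfl⟩ : ∃ a b v', v = a :: b :: v' := by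
    match v, h.1 with
    | a :: b :: v', _ => exact ⟨a, b, v', rfl⟩
    | [], h | [_], h => simp at h
  replace h := h.2
  set r := [false, !b]
  have hr1 : Disj (a :: b :: v) r := by simp [r]
  have hr2 : Disj r ([true] ++ t) := by simp [r]
  have hm : ∀ p q, swap p q ∈ Γ gm := fun p q => V_le_Γ gm (swap_mem_V p q)
  refine ⟨[true, !b], r, [false, b], rfl, rfl, rfl, swap (a :: b :: v) r,
    ⟨hm _ _, swap_mem_Fix (by simp) (by simp [r])⟩,
    swap (a :: b :: v) r * g * swap r ([true] ++ t), ⟨mul_mem (mul_mem (hm _ _) hg) (hm _ _), ?_⟩,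
    swap r ([true] ++ t), ⟨hm _ _, swap_mem_Fix (by simp [r]) (by simp)⟩, ?_⟩
  · intro y
    rw [Perm.mul_apply, Perm.mul_apply, swap_left hr2, h, swap_left hr1]
  · rw [mul_assoc, mul_assoc, mul_assoc, swap_mul_self, mul_one, ← mul_assoc, swap_mul_self, one_mul]

/-- The action of `Γ gm` on the cone of `u`, as an endomorphism of `Γ gm`. -/
def σΓ (u : List Bool) : Γ gm →* Γ gm :=
  ((σ u).comp (Γ gm).subtype).codRestrict (Γ gm) fun g => σ_mem_Γ u g.2

@[simp] lemma coe_σΓ (u : List Bool) (g : Γ gm) : (σΓ u g : Perm ℕ) = σ u g := rfl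

lemma σΓ_append (u v : List Bool) (g : Γ gm) : σΓ (u ++ v) g = σΓ u (σΓ v g) :=
  Subtype.ext (σ_append u v g)

/-- The pointwise stabilizer of the cone of `w` in `Γ gm`. -/
def FixΓ (w : List Bool) : Subgroup (Γ gm) := (Fix w).comap (Γ gm).subtype

lemma exists_conj_eq_σΓ {u w : List Bool} (hu : u ≠ []) (hw : w ≠ []) :
    ∃ v : Γ gm, ∀ g ∈ FixΓ w, v * g * v⁻¹ = σΓ u g := by
  obtain ⟨v, hv, -, h⟩ := exists_mem_Γ_conj (gm := gm) hu hw
  exact ⟨⟨v, hv⟩, fun g hg => Subtype.ext (h g hg)⟩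

lemma exists_conj_σΓ {u w : List Bool} (hu : u ≠ []) (hw : w ≠ []) :
    ∃ t : Γ gm, ∀ g, t * σΓ u g * t⁻¹ = σΓ w g := by
  obtain ⟨t, ht, h⟩ := exists_mem_Γ_map (gm := gm) hu hw
  exact ⟨⟨t, ht⟩, fun g => Subtype.ext (conj_σ' h)⟩

/-- The diagonal embedding of `Γ gm` into the product of its copies acting on the two halves. -/
def doubling : Γ gm →* Γ gm :=
  MonoidHom.mk' (fun g => σΓ [false] g * σΓ [true] g) fun g h => by
    have c : Commute (σΓ [true] g) (σΓ [false] h) :=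
      Subtype.ext (commute_σ_σ (by simp) _ _).eq
    rw [map_mul, map_mul, mul_assoc, ← mul_assoc (σΓ [false] h), ← c.eq]
    simp only [mul_assoc]

lemma doubling_apply (g : Γ gm) : doubling g = σΓ [false] g * σΓ [true] g := rfl

/-- Quasi-morphisms are bounded on the copy of `Γ gm` supported on a half. -/
lemma quasimorphism_bounded {κ : Γ gm → ℝ} {D : ℝ}
    (hκ : ∀ g h, |κ (g * h) - κ g - κ h| ≤ D) : ∃ E, ∀ g, |κ (σΓ [false] g)| ≤ E := by
  have hconj : ∀ t x, |κ (t * x * t⁻¹) - κ x| ≤ 2 * D + |κ t + κ t⁻¹| := by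
    intro t x
    have h1 := abs_le.1 (hκ (t * x) t⁻¹)
    have h2 := abs_le.1 (hκ t x)
    have h3 := abs_le.1 (le_refl |κ t + κ t⁻¹|)
    exact abs_le.2 ⟨by linarith, by linarith⟩
  obtain ⟨t₁, h₁⟩ := exists_conj_σΓ (gm := gm) (u := [false]) (w := [false, false])
    (by simp) (by simp)
  obtain ⟨t₂, h₂⟩ := exists_conj_σΓ (gm := gm) (u := [false]) (w := [false, true])
    (by simp) (by simp)
  refine exists_bound_of_doubling (q := fun g => κ (σΓ [false] g)) (D := D)
    (E := 5 * D + |κ t₁ + κ t₁⁻¹| + |κ t₂ + κ t₂⁻¹|) (fun g h => ?_) doubling (fun g => ?_)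
    hom_apply_eq_one
  · rw [map_mul]
    exact hκ _ _
  · rw [doubling_apply, map_mul, ← σΓ_append, ← σΓ_append]
    have e1 := abs_le.1 (hκ (σΓ [false, false] g) (σΓ [false, true] g))
    have e2 := abs_le.1 (hconj t₁ (σΓ [false] g))
    have e3 := abs_le.1 (hconj t₂ (σΓ [false] g))
    rw [h₁] at e2
    rw [h₂] at e3
    exact abs_le.2 ⟨by simp only [List.cons_append, List.nil_append]; linarith,
      by simp only [List.cons_append, List.nil_append]; linarith⟩

lemma exists_eq_mul_mul_FixΓ (g : Γ gm) :
    ∃ w₁ w₂ w₃ : List Bool, w₁.length = 2 ∧ w₂.length = 2 ∧ w₃.length = 2 ∧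
      ∃ s₁ ∈ FixΓ (gm := gm) w₁, ∃ s₂ ∈ FixΓ (gm := gm) w₂, ∃ s₃ ∈ FixΓ (gm := gm) w₃,
        g = s₁ * s₂ * s₃ := by
  obtain ⟨w₁, w₂, w₃, h₁, h₂, h₃, s₁, hs₁, s₂, hs₂, s₃, hs₃, e⟩ := exists_eq_mul_mul g.2
  exact ⟨w₁, w₂, w₃, h₁, h₂, h₃, ⟨s₁, hs₁.1⟩, hs₁.2, ⟨s₂, hs₂.1⟩, hs₂.2, ⟨s₃, hs₃.1⟩, hs₃.2,
    Subtype.ext e⟩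

lemma ne_nil_of_length_eq_two {w : List Bool} (h : w.length = 2) : w ≠ [] := by
  rintro rfl
  simp at h

lemma len_bounded (L : HypLength (Γ gm)) {z : List Bool} (hz : z ≠ []) {C : ℝ}
    (h : ∀ g, L.len (σΓ z g) ≤ C) : ∃ C', ∀ g, L.len g ≤ C' := by
  have h1 : ∀ w : List Bool, ∃ R, w ≠ [] → ∀ g ∈ FixΓ w, L.len g ≤ R := by
    intro w
    by_cases hw : w = []
    · exact ⟨0, fun h => absurd hw h⟩
    obtain ⟨v, hv⟩ := exists_conj_eq_σΓ (gm := gm) hz hw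
    refine ⟨C + 2 * L.len v, fun _ g hg => ?_⟩
    have e : g = v⁻¹ * σΓ z g * v := by
      rw [← hv g hg]
      group
    have m1 := L.len_mul (v⁻¹ * σΓ z g) v
    have m2 := L.len_mul v⁻¹ (σΓ z g)
    rw [← e] at m1
    rw [L.len_inv] at m2
    linarith [h g]
  choose R hR using h1
  obtain ⟨M, hM⟩ := ((List.finite_length_eq Bool 2).image R).bddAbove
  have h2 : ∀ w : List Bool, w.length = 2 → ∀ g ∈ FixΓ w, L.len g ≤ M := fun w hw g hg =>
    (hR w (ne_nil_of_length_eq_two hw) g hg).trans (hM ⟨w, hw, rfl⟩)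
  refine ⟨3 * M, fun g => ?_⟩
  obtain ⟨w₁, w₂, w₃, l₁, l₂, l₃, s₁, hs₁, s₂, hs₂, s₃, hs₃, rfl⟩ := exists_eq_mul_mul_FixΓ g
  linarith [L.len_mul (s₁ * s₂) s₃, L.len_mul s₁ s₂, h2 _ l₁ _ hs₁, h2 _ l₂ _ hs₂, h2 _ l₃ _ hs₃]

/-- No element of `Γ gm` essentially doubles its length when squared. -/
theorem exists_len_mul_self_le (L : HypLength (Γ gm)) :
    ∃ C', ∀ g, L.len (g * g) ≤ L.len g + C' := by
  by_cases hbdd : ∃ z ≠ [], ∃ C, ∀ g, L.len (σΓ z g) ≤ C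
  · obtain ⟨z, hz, C, h⟩ := hbdd
    obtain ⟨C', hC'⟩ := len_bounded L hz h
    exact ⟨C', fun g => (L.len_mul g g).trans (by linarith [hC' g])⟩
  push Not at hbdd
  have hsq : ∀ w ≠ [], ∀ a ∈ FixΓ w, L.len (a * a) ≤ L.len a + (3 * L.δ + 1) := by
    intro w hw a ha
    by_contra! hlt
    have hcomm : ∀ g, Commute a (σΓ w g) := fun g => Subtype.ext (commute_of_mem_Fix ha _)
    obtain ⟨κ, D, M, hκ, hlen⟩ := HypLength.exists_quasimorphism hlt.le (σΓ w) hcomm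
    obtain ⟨E, hE⟩ := quasimorphism_bounded hκ
    obtain ⟨g, hg⟩ := hbdd (w ++ [false]) (by simp) (E * L.len a + M)
    rw [σΓ_append] at hg
    have := mul_le_mul_of_nonneg_right (hE g) (L.len_nonneg a)
    linarith [hlen (σΓ [false] g)]
  have hsepw : ∀ w z : List Bool, w.length < z.length → ∃ t, Disj z (w ++ t) := by
    intro w z h
    rcases exists_append_of_length h.le with ⟨t, rfl⟩ | h'
    · cases t with
      | nil => simp at h
      | cons b t => exact ⟨[!b], by simp⟩
    · exact ⟨[], by simpa using h'.symm⟩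
  have hK : ∀ z u : List Bool, Disj z u → (σΓ (gm := gm) z).range ≤ FixΓ u := by
    rintro z u h _ ⟨g, rfl⟩
    exact σ_mem_Fix h _
  refine L.exists_len_mul_self_le (ι := {w : List Bool // w ≠ []}) (fun w => FixΓ w)
    (fun z => (σΓ z).range) (C := 3 * L.δ + 1) (by linarith [L.δ_nonneg])
    (fun w => hsq w w.2) ?_ ?_ ?_ ?_
  · rintro ⟨w₁, h₁⟩ ⟨w₂, h₂⟩
    set z := List.replicate (w₁.length + w₂.length + 1) true
    obtain ⟨t₁, ht₁⟩ := hsepw w₁ z (by simp [z])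
    obtain ⟨t₂, ht₂⟩ := hsepw w₂ z (by simp [z])
    exact ⟨⟨z, by simp [z]⟩, ⟨w₁ ++ t₁, by simp [h₁]⟩, ⟨w₂ ++ t₂, by simp [h₂]⟩,
      fun g hg => Fix_le_append _ _ hg, hK _ _ ht₁, fun g hg => Fix_le_append _ _ hg, hK _ _ ht₂⟩
  · rintro ⟨w, hw⟩ g
    obtain ⟨t, v, h⟩ := exists_tame (Γ_le_LocSim g.2) w
    refine ⟨⟨v ++ [false], by simp⟩, fun c hc => ?_⟩
    refine conj_mem_Fix (u := w ++ (t ++ [false])) (fun y => ?_) (Fix_le_append _ _ hc)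
    rw [← List.append_assoc, cw_append, h, cw_append]
  · rintro ⟨z, hz⟩ R
    obtain ⟨g, hg⟩ := hbdd z hz R
    exact ⟨_, ⟨g, rfl⟩, hg.le⟩
  · intro g
    obtain ⟨w₁, w₂, w₃, l₁, l₂, l₃, h⟩ := exists_eq_mul_mul_FixΓ g
    exact ⟨⟨w₁, ne_nil_of_length_eq_two l₁⟩, ⟨w₂, ne_nil_of_length_eq_two l₂⟩,
      ⟨w₃, ne_nil_of_length_eq_two l₃⟩, h⟩

end Group

end Cone

/-! ### Length functions coming from actions, and property (NL) -/

/-- The restriction of a hyperbolic length function along a homomorphism. -/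
def HypLength.comap {Γ Δ : Type*} [Group Γ] [Group Δ] (L : HypLength Γ) (f : Δ →* Γ) :
    HypLength Δ where
  len g := L.len (f g)
  len_one := by rw [map_one, L.len_one]
  len_inv a := by rw [map_inv, L.len_inv]
  len_mul a b := by rw [map_mul]; exact L.len_mul _ _
  δ := L.δ
  δ_nonneg := L.δ_nonneg
  hyp a b c := by simpa only [map_mul, map_inv] using L.hyp (f a) (f b) (f c)

lemma IsIsomAction.dist_act_act {H X : Type*} [Group H] [MetricSpace X] {act : H → X → X}
    (h : IsIsomAction H X act) (x : X) (a b : H) :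
    dist (act a x) (act b x) = dist x (act (a⁻¹ * b) x) := by
  rw [h.act_mul, ← h.isometry a⁻¹, ← h.act_mul a⁻¹ a, inv_mul_cancel, h.act_one]

/-- The displacement of a point by an isometric action on a hyperbolic space. -/
def HypLength.ofAction {H X : Type*} [Group H] [MetricSpace X] {act : H → X → X}
    (h : IsIsomAction H X act) (hX : FourPointHyperbolic (dist : X → X → ℝ)) (x : X) :
    HypLength H where
  len g := dist x (act g x)
  len_one := by rw [h.act_one, dist_self]
  len_inv a := by
    have := h.dist_act_act x a 1
    rw [h.act_one, mul_one] at this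
    rw [← this, dist_comm]
  len_mul a b := by
    have := h.dist_act_act x a (a * b)
    rw [inv_mul_cancel_left] at this
    rw [← this]
    exact dist_triangle _ _ _
  δ := hX.choose
  δ_nonneg := hX.choose_spec.1
  hyp a b c := by
    have := hX.choose_spec.2 x (act a x) (act b x) (act c x)
    simpa only [gromovProd, h.dist_act_act] using this

lemma propNL_of_len {H : Type uG} [Group H]
    (hH : ∀ L : HypLength H, ∃ C, ∀ g, L.len (g * g) ≤ L.len g + C) : PropNL.{uX, uG} H := by
  rintro A g ⟨x, a, b, ha, hb, hqi⟩
  set L := HypLength.ofAction A.isIsomAction (A.rips.fourPointHyperbolic A.δ_nonneg A.geodesic) x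
  obtain ⟨C, hC⟩ := hH L
  have hlow : ∀ n : ℕ, (n : ℝ) / a - b ≤ L.len (g ^ n) := by
    intro n
    have := (hqi 0 n).1
    simpa [zdist, A.isIsomAction.act_one, L, HypLength.ofAction] using this
  have hup : ∀ k : ℕ, L.len (g ^ 2 ^ k) ≤ L.len g + k * C := by
    intro k
    induction k with
    | zero => simp
    | succ k ih =>
      have := hC (g ^ 2 ^ k)
      rw [← pow_add, ← two_mul, ← pow_succ'] at this
      push_cast
      linarith
  set R := a * (|C| * 2 + L.len g + b)
  obtain ⟨k, hk⟩ := exists_nat_gt R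
  have h1 := (hlow _).trans (hup (2 * k))
  have h2 : (k + 1 : ℝ) ≤ 2 ^ k := by exact_mod_cast Nat.lt_two_pow_self
  have h3 : (k + 1 : ℝ) * (k + 1) ≤ 2 ^ (2 * k) := by
    rw [two_mul, pow_add]
    exact mul_le_mul h2 h2 (by positivity) (by positivity)
  have h4 : ((2 ^ (2 * k) : ℕ) : ℝ) ≤ a * (L.len g + (2 * k : ℕ) * C + b) := by
    rw [sub_le_iff_le_add, div_le_iff₀ (by linarith)] at h1
    linarith
  push_cast at h4
  have h5 : L.len g + 2 * k * C + b ≤ (|C| * 2 + L.len g + b) * (k + 1) := by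
    have e1 : (k : ℝ) * C ≤ k * |C| := mul_le_mul_of_nonneg_left (le_abs_self C) k.cast_nonneg
    have e2 := mul_nonneg (add_nonneg (L.len_nonneg g) hb) (k.cast_nonneg (α := ℝ))
    nlinarith [abs_nonneg C]
  have h6 := mul_le_mul_of_nonneg_left h5 (by linarith : 0 ≤ a)
  have h7 : (k + 1 : ℝ) * (k + 1) ≤ R * (k + 1) := by
    calc _ ≤ _ := h3.trans (h4.trans h6)
      _ = _ := by ring
  have h8 := le_of_mul_le_mul_right h7 (by positivity)
  linarith

lemma exists_injective_hom_perm_nat (G : Type*) [Group G] [Countable G] :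
    ∃ f : G →* Equiv.Perm ℕ, Function.Injective f := by
  obtain ⟨i, hi⟩ := exists_injective_nat G
  exact ⟨(Equiv.Perm.viaEmbeddingHom ⟨i, hi⟩).comp (MulAction.toPermHom G G),
    (Equiv.Perm.viaEmbeddingHom_injective _).comp MulAction.toPerm_injective⟩

/-- every countable group with an element of infinite order embeds into a
finitely generated simple group with property (NL). -/
theorem stmt_13 (G : Type uG) [Group G] [Countable G] (hinf : ∃ g : G, ¬ IsOfFinOrder g) :
    ∃ E : EmbeddingIntoGroup G,
      Group.FG E.target ∧ IsSimpleGroup E.target ∧ PropNL.{uX, uG} E.target := by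
  obtain ⟨f, hf⟩ := exists_injective_hom_perm_nat G
  obtain ⟨e, he⟩ := exists_surjective_nat G
  let gm : ℕ → Equiv.Perm ℕ := fun m => f (e m)
  have hmem : ∀ g, Cone.σ [false] (Cone.permCones (f g)) ∈ Cone.Γ gm := by
    intro g
    obtain ⟨m, rfl⟩ := he g
    exact Cone.σ_permCones_mem_Γ (gm := gm) m
  let up : Cone.Γ gm →* ULift.{uG} (Cone.Γ gm) := MulEquiv.ulift.symm.toMonoidHom
  have hup : Function.Surjective up := MulEquiv.ulift.symm.surjective
  let φ : G →* Cone.Γ gm :=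
    (((Cone.σ [false]).comp Cone.permCones).comp f).codRestrict (Cone.Γ gm) hmem
  have hφ : Function.Injective φ := fun g h hgh =>
    hf (Cone.permCones_injective (Cone.σ_injective _ (congrArg Subtype.val hgh)))
  have := Cone.Γ_isSimpleGroup (gm := gm)
  have := Cone.Γ_fg (gm := gm)
  refine ⟨⟨ULift.{uG} (Cone.Γ gm), up.comp φ, MulEquiv.ulift.symm.injective.comp hφ⟩,
    Group.fg_of_surjective hup, IsSimpleGroup.isSimpleGroup_of_surjective up hup, propNL_of_len fun L => ?_⟩
  obtain ⟨C, hC⟩ := Cone.exists_len_mul_self_le (L.comap up)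
  refine ⟨C, fun g => ?_⟩
  obtain ⟨h, rfl⟩ := hup g
  exact hC h
end
end

section
/- Let C be a nontrivial group in which any two elements of the same order are conjugate, and let S be a subgroup of C that is a simple group, such that for every nontrivial element c ∈ C there exists a nontrivial element s ∈ S with the same order as c. Then C is simple. -/
noncomputable section

open Metric

universe uX uG

/-- a nontrivial group in which elements of the same order are conjugate
and which contains a simple subgroup realizing all orders of nontrivial elements is simple. -/
theorem stmt_14 {C : Type*} [Group C] [Nontrivial C]
    (hconj : ∀ a b : C, orderOf a = orderOf b → IsConj a b)
    (S : Subgroup C) (hS : IsSimpleGroup ↥S)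
    (hord : ∀ c : C, c ≠ 1 → ∃ s : ↥S, (s : C) ≠ 1 ∧ orderOf (s : C) = orderOf c) :
    IsSimpleGroup C := by
  have mem_of_orderOf_eq {N : Subgroup C} (hN : N.Normal) {a b : C} (ha : a ∈ N)
      (h : orderOf a = orderOf b) : b ∈ N := by
    obtain ⟨g, rfl⟩ := isConj_iff.mp (hconj a b h)
    exact hN.conj_mem a ha g
  refine ⟨fun N hN => or_iff_not_imp_left.mpr fun hbot => ?_⟩
  obtain ⟨c, hcN, hc⟩ := N.bot_or_exists_ne_one.resolve_left hbot
  obtain ⟨s, hs, hsc⟩ := hord c hc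
  have hsN : (s : C) ∈ N := mem_of_orderOf_eq hN hcN hsc.symm
  have hSN : N.subgroupOf S = ⊤ := by
    refine (hN.subgroupOf S).eq_bot_or_eq_top.resolve_left fun h => hs ?_
    have : s ∈ N.subgroupOf S := hsN
    rw [h, Subgroup.mem_bot] at this
    exact congrArg Subtype.val this
  refine (Subgroup.eq_top_iff' N).mpr fun d => ?_
  by_cases hd : d = 1
  · exact hd ▸ N.one_mem
  · obtain ⟨t, -, htd⟩ := hord d hd
    exact mem_of_orderOf_eq hN (Subgroup.subgroupOf_eq_top.mp hSN t.2) htd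
end
end
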